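/- arXiv:1912.02489 — 2 statements merged into one kernel-verified Lean document; each statement's English description precedes it below -/
import Mathlib

section
/- An irreducible plane curve of degree n has at most (n−1)(n−2)/2 singular points. -/
open MvPolynomial

variable {k : Type} [Field k]

/-- Iterated partial derivatives along a list of variable indices. -/
noncomputable def pderivList {n : ℕ} (s : List (Fin n)) (F : MvPolynomial (Fin n) k) :
    MvPolynomial (Fin n) k :=
  s.foldr (fun i G => pderiv i G) F

/-- The `m`-th directional derivative of `F` at `v` in direction `w`
(`m!` times the degree-`m` Taylor form). -/
noncomputable def dirDeriv {n : ℕ} (F : MvPolynomial (Fin n) k)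
    (v w : Fin n → k) (m : ℕ) : k :=
  ∑ s : Fin m → Fin n, eval v (pderivList (List.ofFn s) F) * ∏ j, w (s j)

/-- `F` has multiplicity (exactly) `m` at the point `v`: all partial derivatives of
order `< m` vanish at `v`, while some order-`m` derivative does not. -/
def HasMultiplicityAt {n : ℕ} (F : MvPolynomial (Fin n) k) (v : Fin n → k) (m : ℕ) : Prop :=
  (∀ s : List (Fin n), s.length < m → eval v (pderivList s F) = 0) ∧
    ∃ s : List (Fin n), s.length = m ∧ eval v (pderivList s F) ≠ 0

/-- A singular point of the projective plane curve `F = 0`. -/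
def IsSingularAt (F : MvPolynomial (Fin 3) k) (v : Fin 3 → k) : Prop :=
  v ≠ 0 ∧ eval v F = 0 ∧ ∀ i, eval v (pderiv i F) = 0

/-- A node (ordinary double point): multiplicity two with two distinct tangent
directions, i.e. the degree-2 tangent cone is not (a multiple of) a square of a linear form. -/
def IsNodeAt (F : MvPolynomial (Fin 3) k) (v : Fin 3 → k) : Prop :=
  v ≠ 0 ∧ eval v F = 0 ∧ HasMultiplicityAt F v 2 ∧
    ¬ ∃ (c : k) (l : Fin 3 → k), ∀ w : Fin 3 → k,
        dirDeriv F v w 2 = c * (∑ i, l i * w i) ^ 2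

/-- An ordinary point of multiplicity `m`: the degree-`m` tangent cone factors into `m`
pairwise distinct linear forms. -/
def IsOrdinaryAt (F : MvPolynomial (Fin 3) k) (v : Fin 3 → k) (m : ℕ) : Prop :=
  HasMultiplicityAt F v m ∧
    ∃ (c : k) (L : Fin m → (Fin 3 → k)), c ≠ 0 ∧
      (∀ i j, i ≠ j → ¬ ∃ t : k, L j = t • L i) ∧
      ∀ w : Fin 3 → k, dirDeriv F v w m = c * ∏ i, (∑ j, L i j * w j)

/-- An (irreducible) plane algebraic curve of degree `n` in `ℙ²`. -/
structure PlaneCurve (k : Type) [Field k] where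
  n : ℕ
  F : MvPolynomial (Fin 3) k
  homog : F.IsHomogeneous n
  irred : Irreducible F

/-- Birational equivalence of the projective curves `F = 0` and `G = 0`, expressed by a
pair of mutually inverse rational maps given by homogeneous polynomial triples. -/
def BirEquiv (F G : MvPolynomial (Fin 3) k) : Prop :=
  ∃ φ ψ : Fin 3 → MvPolynomial (Fin 3) k,
    (∃ d, ∀ i, (φ i).IsHomogeneous d) ∧
    (∃ e, ∀ i, (ψ i).IsHomogeneous e) ∧
    bind₁ φ G ∈ Ideal.span {F} ∧
    bind₁ ψ F ∈ Ideal.span {G} ∧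
    (∃ lam : MvPolynomial (Fin 3) k, lam ∉ Ideal.span {F} ∧
      ∀ i, bind₁ φ (ψ i) - lam * X i ∈ Ideal.span {F}) ∧
    (∃ mu : MvPolynomial (Fin 3) k, mu ∉ Ideal.span {G} ∧
      ∀ i, bind₁ ψ (φ i) - mu * X i ∈ Ideal.span {G})


theorem linform_eq (f : (Fin 3 → k) →ₗ[k] k) (v : Fin 3 → k) :
    eval v (∑ i, C (f (Pi.single i 1)) * X i : MvPolynomial (Fin 3) k) = f v := by
  conv_rhs => rw [pi_eq_sum_univ' v]
  simp [mul_comm]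

/-- the linear form attached to a functional -/
noncomputable def linform (f : (Fin 3 → k) →ₗ[k] k) : MvPolynomial (Fin 3) k :=
  ∑ i, C (f (Pi.single i 1)) * X i

theorem linform_hom (f : (Fin 3 → k) →ₗ[k] k) : (linform f).IsHomogeneous 1 :=
  IsHomogeneous.sum _ _ _ fun i _ => isHomogeneous_C_mul_X _ i

theorem eval_linform (f : (Fin 3 → k) →ₗ[k] k) (v : Fin 3 → k) :
    eval v (linform f) = f v := linform_eq f v

/-- directional derivative functional at v in direction w -/
noncomputable def dd (v w : Fin 3 → k) : MvPolynomial (Fin 3) k →ₗ[k] k where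
  toFun H := ∑ j, w j * eval v (pderiv j H)
  map_add' := by intro a b; simp [mul_add, Finset.sum_add_distrib]
  map_smul' := by
    intro a b
    simp only [smul_eq_C_mul, Derivation.leibniz, pderiv_C, smul_eq_mul]
    simp only [mul_zero, add_zero, map_mul, eval_C, RingHom.id_apply, Finset.mul_sum]
    exact Finset.sum_congr rfl fun _ _ => by ring

theorem dd_mul (v w : Fin 3 → k) (A B : MvPolynomial (Fin 3) k) :
    dd v w (A * B) = eval v A * dd v w B + eval v B * dd v w A := by
  simp only [dd, LinearMap.coe_mk, AddHom.coe_mk, Derivation.leibniz, smul_eq_mul, map_add, map_mul,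
    Finset.mul_sum, ← Finset.sum_add_distrib]
  exact Finset.sum_congr rfl fun _ _ => by ring

theorem dd_linform (v w : Fin 3 → k) (f : (Fin 3 → k) →ₗ[k] k) :
    dd v w (linform f) = f w := by
  rw [← eval_linform f w]
  simp [dd, linform, Fin.sum_univ_three, pderiv_X]
  ring

theorem exists_sep (u v : Fin 3 → k) (h : ¬ ∃ c : k, v = c • u) :
    ∃ f : (Fin 3 → k) →ₗ[k] k, f u = 0 ∧ f v ≠ 0 := by
  have : v ∉ Submodule.span k {u} := by
    rw [Submodule.mem_span_singleton]
    rintro ⟨c, hc⟩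
    exact h ⟨c, hc.symm⟩
  obtain ⟨f, hf, hp⟩ := Submodule.exists_le_ker_of_notMem this
  exact ⟨f, hp (Submodule.mem_span_singleton_self u), hf⟩

theorem exists_dir (u : Fin 3 → k) (g : (Fin 3 → k) →ₗ[k] k) :
    ∃ w, g w = 0 ∧ ¬ ∃ c : k, w = c • u := by
  by_contra! h
  have h1 : LinearMap.ker g ≤ Submodule.span k {u} := by
    intro w hw
    obtain ⟨c, hc⟩ := h w hw
    rw [Submodule.mem_span_singleton]
    exact ⟨c, hc.symm⟩
  have h2 := Submodule.finrank_mono h1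
  have h3 := finrank_span_le_card (R := k) ({u} : Set (Fin 3 → k))
  have h4 := LinearMap.finrank_range_add_finrank_ker g
  have h5 := Submodule.finrank_le (LinearMap.range g)
  simp at h3 h4 h5
  omega

theorem finrank_hom (d : ℕ) :
    Module.finrank k (homogeneousSubmodule (Fin 3) k d) = (d + 2).choose 2 := by
  classical
  rw [homogeneousSubmodule_eq_finsupp_supported]
  have hs : {c : Fin 3 →₀ ℕ | c.degree = d} =
      ((Finset.univ : Finset (Fin 3)).finsuppAntidiag d : Set (Fin 3 →₀ ℕ)) := by
    ext c
    simp [Finset.mem_finsuppAntidiag, Finsupp.degree_eq_sum]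
  rw [hs]
  have e := AddMonoidAlgebra.supportedEquivFinsupp (R := k) (S := k)
    ((Finset.univ : Finset (Fin 3)).finsuppAntidiag d : Set (Fin 3 →₀ ℕ))
  refine (LinearEquiv.finrank_eq e).trans ?_
  rw [Module.finrank_finsupp_self]
  simp only [Finset.coe_sort_coe, Fintype.card_coe, Finset.card_finsuppAntidiag_nat_eq_choose]
  simp only [Finset.card_univ, Fintype.card_fin]
  rw [show 3 + d - 1 = d + 2 by omega, ← Nat.choose_symm (n := d + 2) (k := d) (by omega)]
  congr 1
  omega

theorem hom_factor {n e : ℕ} {F D : MvPolynomial (Fin 3) k} (hF : F.IsHomogeneous n)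
    (h : (F * D).IsHomogeneous (n + e)) : F * D = F * homogeneousComponent e D := by
  classical
  let _ : GradedAlgebra (homogeneousSubmodule (Fin 3) k) := gradedAlgebra
  have := DirectSum.coe_decompose_mul_add_of_left_mem (homogeneousSubmodule (Fin 3) k)
    (i := n) (j := e) (a := F) (b := D) hF
  rw [DirectSum.decompose_of_mem_same _ h] at this
  rw [this]
  congr 1
  exact decomposition.decompose'_apply D e

theorem surj {ι : Type} [Fintype ι] (Q w : ι → Fin 3 → k)
    (h : ∀ i j, i ≠ j → ¬ ∃ c : k, Q j = c • Q i) (h0 : ∀ i, Q i ≠ 0)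
    (hw : ∀ i, ¬ ∃ c : k, w i = c • Q i) (t : ℕ) (a b : ι → k) :
    ∃ H : MvPolynomial (Fin 3) k, H.IsHomogeneous (2 * Fintype.card ι + t + 1) ∧
      ∀ i, eval (Q i) H = a i ∧ dd (Q i) (w i) H = b i := by
  classical
  have hL : ∀ i j, ∃ f : (Fin 3 → k) →ₗ[k] k, f (Q i) ≠ 0 ∧ (j ≠ i → f (Q j) = 0) := by
    intro i j
    by_cases hij : j = i
    · obtain ⟨f, -, hf⟩ := exists_sep 0 (Q i) (by simpa using h0 i)
      exact ⟨f, hf, fun h => absurd hij h⟩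
    · obtain ⟨f, h1, hf⟩ := exists_sep (Q j) (Q i) (h j i hij)
      exact ⟨f, hf, fun _ => h1⟩
  choose L hL1 hL2 using hL
  have hN : ∀ i, ∃ f : (Fin 3 → k) →ₗ[k] k, f (Q i) = 0 ∧ f (w i) ≠ 0 :=
    fun i => exists_sep (Q i) (w i) (hw i)
  choose N hN1 hN2 using hN
  let E : ι → MvPolynomial (Fin 3) k := fun i =>
    (∏ j, linform (L i j) ^ 2) * linform (L i i) ^ t
  have hEh : ∀ i, (E i).IsHomogeneous (2 * Fintype.card ι + t) := by
    intro i
    have h1 : (∏ j, linform (L i j) ^ 2).IsHomogeneous (∑ j : ι, 2) :=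
      IsHomogeneous.prod _ _ _ fun j _ => by simpa using (linform_hom (L i j)).pow 2
    have h2 := h1.mul ((linform_hom (L i i)).pow t)
    convert h2 using 1
    simp [mul_comm]
  have hE1 : ∀ i, eval (Q i) (E i) ≠ 0 := by
    intro i
    simp only [E, map_mul, map_prod, map_pow, eval_linform]
    exact mul_ne_zero (Finset.prod_ne_zero_iff.2 fun j _ => pow_ne_zero _ (hL1 i j))
      (pow_ne_zero _ (hL1 i i))
  have hE2 : ∀ i j, j ≠ i → ∀ D, eval (Q j) (E i * D) = 0 ∧ dd (Q j) (w j) (E i * D) = 0 := by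
    intro i j hij D
    have : E i * D = linform (L i j) * (linform (L i j) *
        ((∏ j ∈ Finset.univ.erase j, linform (L i j) ^ 2) * linform (L i i) ^ t * D)) := by
      simp only [E]
      rw [← Finset.mul_prod_erase Finset.univ _ (Finset.mem_univ j)]
      ring
    rw [this]
    constructor
    · simp [eval_linform, hL2 i j hij]
    · rw [dd_mul]
      simp [eval_linform, hL2 i j hij]
  let α : ι → k := fun i => a i / eval (Q i) (E i * linform (L i i))
  let β : ι → k := fun i => (b i - α i * dd (Q i) (w i) (E i * linform (L i i))) /
    dd (Q i) (w i) (E i * linform (N i))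
  have hA : ∀ i, eval (Q i) (E i * linform (L i i)) ≠ 0 := by
    intro i
    rw [map_mul, eval_linform]
    exact mul_ne_zero (hE1 i) (hL1 i i)
  have hB : ∀ i, dd (Q i) (w i) (E i * linform (N i)) ≠ 0 := by
    intro i
    rw [dd_mul, dd_linform, eval_linform, hN1, zero_mul, add_zero]
    exact mul_ne_zero (hE1 i) (hN2 i)
  refine ⟨∑ i, (α i • (E i * linform (L i i)) + β i • (E i * linform (N i))), ?_, ?_⟩
  · refine IsHomogeneous.sum _ _ _ fun i _ => IsHomogeneous.add ?_ ?_
    · exact (homogeneousSubmodule (Fin 3) k _).smul_mem _ ((hEh i).mul (linform_hom _))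
    · exact (homogeneousSubmodule (Fin 3) k _).smul_mem _ ((hEh i).mul (linform_hom _))
  · intro i
    constructor
    · rw [map_sum, Finset.sum_eq_single i]
      · have : eval (Q i) (E i * linform (N i)) = 0 := by simp [eval_linform, hN1]
        rw [map_add, smul_eval, smul_eval, this, mul_zero, add_zero]
        exact div_mul_cancel₀ _ (hA i)
      · intro j _ hj
        rw [map_add, smul_eval, smul_eval, (hE2 j i hj.symm _).1, (hE2 j i hj.symm _).1]
        simp
      · simp
    · rw [map_sum, Finset.sum_eq_single i]
      · rw [map_add, map_smul, map_smul, smul_eq_mul, smul_eq_mul]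
        simp only [β]
        rw [div_mul_cancel₀ _ (hB i)]
        ring
      · intro j _ hj
        rw [map_add, map_smul, map_smul, (hE2 j i hj.symm _).2, (hE2 j i hj.symm _).2]
        simp
      · simp

theorem exists_adjoint {ι : Type} [Fintype ι] (Q : ι → Fin 3 → k) (m : ℕ)
    (h : Fintype.card ι < (m + 2).choose 2) :
    ∃ G : MvPolynomial (Fin 3) k, G.IsHomogeneous m ∧ G ≠ 0 ∧ ∀ i, eval (Q i) G = 0 := by
  have : Module.Finite k (homogeneousSubmodule (Fin 3) k m) :=
    Module.Finite.iff_fg.2 (homogeneousSubmodule_fg (Fin 3) k m)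
  let f : homogeneousSubmodule (Fin 3) k m →ₗ[k] (ι → k) :=
    (LinearMap.pi fun i => (aeval (R := k) (Q i)).toLinearMap) ∘ₗ Submodule.subtype _
  have : LinearMap.ker f ≠ ⊥ := by
    apply LinearMap.ker_ne_bot_of_finrank_lt
    rw [finrank_hom]
    simpa using h
  obtain ⟨G, hG, hG0⟩ := Submodule.exists_mem_ne_zero_of_ne_bot this
  refine ⟨G.1, G.2, fun h => hG0 (Subtype.ext h), fun i => ?_⟩
  have := congrFun (LinearMap.mem_ker.1 hG) i
  exact this

theorem bezout {ι : Type} [Fintype ι] (T : Finset ι) (Q : ι → Fin 3 → k)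
    (h : ∀ i j, i ≠ j → ¬ ∃ c : k, Q j = c • Q i) (h0 : ∀ i, Q i ≠ 0)
    {n m : ℕ} {F G : MvPolynomial (Fin 3) k} (hF : F.IsHomogeneous n) (hG : G.IsHomogeneous m)
    (hirr : Irreducible F) (hFG : ¬ F ∣ G)
    (hQF : ∀ i, eval (Q i) F = 0) (hQG : ∀ i, eval (Q i) G = 0)
    (hT : ∀ i ∈ T, ∀ j, eval (Q i) (pderiv j F) = 0) :
    Fintype.card ι + T.card ≤ n * m := by
  classical
  have : ∀ d, Module.Finite k (homogeneousSubmodule (Fin 3) k d) :=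
    fun d => Module.Finite.iff_fg.2 (homogeneousSubmodule_fg (Fin 3) k d)
  have hw : ∀ i, ∃ w, dd (Q i) w G = 0 ∧ ¬ ∃ c : k, w = c • Q i := by
    intro i
    obtain ⟨w, h1, h2⟩ := exists_dir (Q i)
      (∑ j, (eval (Q i) (pderiv j G)) • LinearMap.proj (R := k) (φ := fun _ : Fin 3 => k) j)
    refine ⟨w, ?_, h2⟩
    rw [← h1]
    simp [dd, mul_comm]
  choose w hw1 hw2 using hw
  obtain ⟨e, he⟩ : ∃ e, e = 2 * Fintype.card ι + 1 := ⟨_, rfl⟩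
  let S := fun d => homogeneousSubmodule (Fin 3) k d
  let Φ : S (n + m + e) →ₗ[k] (ι → k) × (T → k) :=
    (LinearMap.prod (LinearMap.pi fun i => (aeval (R := k) (Q i)).toLinearMap)
      (LinearMap.pi fun i : T => dd (Q i) (w i))) ∘ₗ Submodule.subtype _
  have hΦ : Function.Surjective Φ := by
    rintro ⟨a, b⟩
    obtain ⟨H, hH, hH2⟩ := surj Q w h h0 hw2 (n + m) a
      (fun i => if hi : i ∈ T then b ⟨i, hi⟩ else 0)
    refine ⟨⟨H, ?_⟩, ?_⟩
    · have hd : n + m + e = 2 * Fintype.card ι + (n + m) + 1 := by omega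
      change H.IsHomogeneous (n + m + e)
      rw [hd]
      exact hH
    · ext i
      · exact (hH2 i).1
      · simpa [Φ] using (hH2 i).2
  let Ψ : S (m + e) × S (n + e) →ₗ[k] S (n + m + e) :=
    LinearMap.coprod
      ((LinearMap.mulLeft k F).restrict (fun A hA => by
        have := hF.mul (show A.IsHomogeneous (m + e) from hA)
        rw [← add_assoc] at this
        exact this))
      ((LinearMap.mulLeft k G).restrict (fun A hA => by
        have := hG.mul (show A.IsHomogeneous (n + e) from hA)
        rw [← add_assoc, add_comm m n] at this
        exact this))
  let Θ : S e →ₗ[k] S (m + e) × S (n + e) :=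
    LinearMap.prod
      ((LinearMap.mulLeft k (-G)).restrict (fun A hA =>
        (hG.neg).mul (show A.IsHomogeneous e from hA)))
      ((LinearMap.mulLeft k F).restrict (fun A hA => hF.mul (show A.IsHomogeneous e from hA)))
  have hΨ : ∀ A B, (Ψ (A, B)).1 = F * A.1 + G * B.1 := by
    intro A B
    rfl
  have h1 : LinearMap.range Ψ ≤ LinearMap.ker Φ := by
    rintro _ ⟨⟨A, B⟩, rfl⟩
    rw [LinearMap.mem_ker]
    have hev : ∀ i, eval (Q i) (F * A.1 + G * B.1) = 0 := by
      intro i; simp [hQF, hQG]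
    have hdd : ∀ i ∈ T, dd (Q i) (w i) (F * A.1 + G * B.1) = 0 := by
      intro i hi
      have : dd (Q i) (w i) F = 0 := by simp [dd, hT i hi]
      rw [map_add, dd_mul, dd_mul, hQF, hQG, hw1, this]
      simp
    ext i
    · have := hev i
      rw [← hΨ] at this
      exact this
    · have := hdd i i.2
      rw [← hΨ] at this
      simpa [Φ] using this
  have h2 : LinearMap.ker Ψ ≤ LinearMap.range Θ := by
    rintro ⟨A, B⟩ hAB
    rw [LinearMap.mem_ker] at hAB
    have h3 : F * A.1 + G * B.1 = 0 := by rw [← hΨ, hAB]; rfl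
    have hdvd : F ∣ G * B.1 := ⟨-A.1, by linear_combination h3⟩
    obtain ⟨D, hD⟩ := (hirr.prime.dvd_or_dvd hdvd).resolve_left hFG
    have hB : (F * D).IsHomogeneous (n + e) := hD ▸ B.2
    rw [hom_factor hF hB] at hD
    have hA : A.1 = -G * homogeneousComponent e D := by
      apply mul_left_cancel₀ hirr.ne_zero
      rw [hD] at h3
      linear_combination h3
    refine ⟨⟨homogeneousComponent e D, homogeneousComponent_isHomogeneous e D⟩, ?_⟩
    refine Prod.ext (Subtype.ext ?_) (Subtype.ext ?_)
    · exact hA.symm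
    · exact hD.symm
  have r1 := LinearMap.finrank_range_add_finrank_ker Φ
  have r2 := LinearMap.finrank_range_add_finrank_ker Ψ
  have r3 := Submodule.finrank_mono h1
  have r4 := Submodule.finrank_mono h2
  have r5 := LinearMap.finrank_range_le Θ
  rw [LinearMap.range_eq_top.2 hΦ, finrank_top] at r1
  simp only [S, Module.finrank_prod, finrank_hom, Module.finrank_fintype_fun_eq_card,
    Fintype.card_coe] at r1 r2 r5
  have c : ∀ d : ℕ, 2 * (d + 2).choose 2 = (d + 2) * (d + 1) := by
    intro d
    rw [Nat.choose_two_right, Nat.mul_div_cancel' (Nat.even_mul_pred_self _).two_dvd]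
    rfl
  have c1 := c (n + m + e)
  have c2 := c (m + e)
  have c3 := c (n + e)
  have c4 := c e
  nlinarith

theorem not_dvd_of_lt {n m : ℕ} {F G : MvPolynomial (Fin 3) k} (hF : F.IsHomogeneous n)
    (hG : G.IsHomogeneous m) (hG0 : G ≠ 0) (h : m < n) : ¬ F ∣ G := by
  rintro ⟨D, rfl⟩
  have h1 := hG.totalDegree hG0
  have h2 := mul_ne_zero_iff.1 hG0
  rw [totalDegree_mul_of_isDomain h2.1 h2.2, hF.totalDegree h2.1] at h1
  omega

theorem exists_point [IsAlgClosed k] {n : ℕ} (hn : 2 ≤ n) {F : MvPolynomial (Fin 3) k}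
    (hF : F.IsHomogeneous n) (hirr : Irreducible F) (s : Finset (Fin 3 → k)) :
    ∃ y, eval y F = 0 ∧ ∀ x ∈ s, ¬ ∃ c : k, y = c • x := by
  have hf : ∀ x : Fin 3 → k, ∃ f : (Fin 3 → k) →ₗ[k] k, f x = 0 ∧ linform f ≠ 0 := by
    intro x
    obtain ⟨w, -, hw⟩ := exists_dir x 0
    obtain ⟨f, h1, h2⟩ := exists_sep x w hw
    refine ⟨f, h1, fun h => h2 ?_⟩
    rw [← eval_linform, h, map_zero]
  choose f hf1 hf2 using hf
  by_contra! hcon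
  have hmem : (∏ x ∈ s, linform (f x)) ∈
      vanishingIdeal k (zeroLocus k (Ideal.span {F})) := by
    rw [mem_vanishingIdeal_iff]
    intro y hy
    have hy' : eval y F = 0 := hy F (Ideal.mem_span_singleton_self F)
    obtain ⟨x, hx, c, hc⟩ := hcon y hy'
    rw [map_prod]
    refine Finset.prod_eq_zero hx ?_
    change eval y (linform (f x)) = 0
    rw [eval_linform, hc, map_smul, hf1, smul_zero]
  have : (Ideal.span {F}).IsPrime := (Ideal.span_singleton_prime hirr.ne_zero).2 hirr.prime
  rw [vanishingIdeal_zeroLocus_eq_radical, this.radical, Ideal.mem_span_singleton,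
    hirr.prime.dvd_finset_prod_iff] at hmem
  obtain ⟨x, -, hx⟩ := hmem
  exact not_dvd_of_lt hF (linform_hom (f x)) (hf2 x) (by omega) hx

theorem prop_symm {x y : Fin 3 → k} (hx : x ≠ 0) (h : ¬ ∃ c : k, y = c • x) :
    ¬ ∃ c : k, x = c • y := by
  rintro ⟨c, hc⟩
  have hc0 : c ≠ 0 := by rintro rfl; exact hx (by simpa using hc)
  exact h ⟨c⁻¹, by rw [hc, smul_smul, inv_mul_cancel₀ hc0, one_smul]⟩

/-- An irreducible plane curve of degree `n` has at most
`(n−1)(n−2)/2` singular points. -/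
theorem card_singular_points_le
    (k : Type) [Field k] [IsAlgClosed k] [CharZero k] (C : PlaneCurve k)
    (K : ℕ) (P : Fin K → (Fin 3 → k))
    (hdist : ∀ i j, i ≠ j → ¬ ∃ c : k, P j = c • P i)
    (hsing : ∀ i, IsSingularAt C.F (P i)) :
    K ≤ (C.n - 1) * (C.n - 2) / 2 := by
  by_contra! hK
  obtain ⟨n, F, hF, hirr⟩ := C
  simp only at hsing hK
  rcases Nat.lt_or_ge n 2 with hn | hn
  · have hp := hsing ⟨0, by omega⟩
    have hconst : ∀ (G : MvPolynomial (Fin 3) k) (v : Fin 3 → k), G.IsHomogeneous 0 →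
        eval v G = 0 → G = 0 := by
      intro G v hG hv
      rw [← totalDegree_zero_iff_isHomogeneous, totalDegree_eq_zero_iff_eq_C] at hG
      rw [hG, eval_C] at hv
      rw [hG, hv, C_0]
    apply hirr.ne_zero
    interval_cases n
    · exact hconst F _ hF hp.2.1
    · have := hF.sum_X_mul_pderiv
      rw [one_smul] at this
      rw [← this]
      refine Finset.sum_eq_zero fun i _ => ?_
      rw [hconst _ _ hF.pderiv (hp.2.2 i), mul_zero]
  · classical
    let N := (n - 1) * (n - 2) / 2 + 1
    have hN : N ≤ K := hK
    let P' : Fin N → Fin 3 → k := fun i => P (Fin.castLE hN i)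
    obtain ⟨R, hR1, hR2⟩ := exists_seq_of_forall_finset_exists
      (fun y : Fin 3 → k => y ≠ 0 ∧ eval y F = 0 ∧ ∀ i, ¬ ∃ c : k, y = c • P' i)
      (fun x y => ¬ ∃ c : k, y = c • x) (by
        intro s _
        obtain ⟨y, hy, hy2⟩ := exists_point hn hF hirr (insert 0 (s ∪ Finset.univ.image P'))
        refine ⟨y, ⟨?_, hy, fun i => hy2 _ (by simp)⟩, fun x hx => hy2 x (by simp [hx])⟩
        rintro rfl
        exact hy2 0 (by simp) ⟨0, by simp⟩)
    let Q : Fin N ⊕ Fin (2 * n - 3) → Fin 3 → k := Sum.elim P' (fun i => R i)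
    have hdiv : 2 * ((n - 1) * (n - 2) / 2) = (n - 1) * (n - 2) := by
      apply Nat.mul_div_cancel'
      have := (Nat.even_mul_pred_self (n - 1)).two_dvd
      rwa [Nat.sub_sub] at this
    obtain ⟨a, rfl⟩ : ∃ a, n = a + 2 := ⟨n - 2, by omega⟩
    have e1 : a + 2 - 1 = a + 1 := by omega
    have e2 : a + 2 - 2 = a := by omega
    have e3 : 2 * (a + 2) - 3 = 2 * a + 1 := by omega
    have hN2 : 2 * N = (a + 1) * a + 2 := by
      simp only [N]
      rw [mul_add, hdiv, e1, e2]
    have hch : 2 * (a + 1 + 2).choose 2 = (a + 3) * (a + 2) := by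
      rw [Nat.choose_two_right, Nat.mul_div_cancel' (Nat.even_mul_pred_self _).two_dvd]
      rfl
    have hQ0 : ∀ i, Q i ≠ 0 := by
      rintro (i | i)
      · exact (hsing _).1
      · exact (hR1 _).1
    have hQ : ∀ i j, i ≠ j → ¬ ∃ c : k, Q j = c • Q i := by
      rintro (i | i) (j | j) hij
      · exact hdist _ _ fun h => hij (by rw [Fin.castLE_injective hN h])
      · exact (hR1 _).2.2 i
      · exact prop_symm (hQ0 (Sum.inl j)) ((hR1 _).2.2 j)
      · have hij' : i.1 ≠ j.1 := fun h => hij (by rw [Fin.ext h])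
        rcases lt_or_gt_of_ne hij' with h | h
        · exact hR2 _ _ h
        · exact prop_symm (hR1 _).1 (hR2 _ _ h)
    have hQF : ∀ i, eval (Q i) F = 0 := by
      rintro (i | i)
      · exact (hsing _).2.1
      · exact (hR1 _).2.1
    obtain ⟨G, hG, hG0, hQG⟩ := exists_adjoint Q (a + 1) (by
      simp only [Fintype.card_sum, Fintype.card_fin, e3]
      nlinarith)
    have := bezout (Finset.univ.image Sum.inl) Q hQ hQ0 hF hG hirr
      (not_dvd_of_lt hF hG hG0 (by omega)) hQF hQG (by
        intro i hi j
        obtain ⟨i, -, rfl⟩ := Finset.mem_image.1 hi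
        exact (hsing _).2.2 j)
    rw [Finset.card_image_of_injective _ Sum.inl_injective] at this
    simp only [Fintype.card_sum, Fintype.card_fin, Finset.card_univ, e3] at this
    nlinarith
end

section
/- A smooth cubic surface in P^3 over an algebraically closed field contains exactly 27 lines. -/
namespace Cubic27

section Alg
variable {k : Type*} [Field k]

/-- A cubic polynomial function which vanishes identically has zero coefficients. -/
lemma cubic_coeffs_zero [Infinite k] {c0 c1 c2 c3 : k}
    (h : ∀ s : k, c0 + c1 * s + c2 * s ^ 2 + c3 * s ^ 3 = 0) :
    c0 = 0 ∧ c1 = 0 ∧ c2 = 0 ∧ c3 = 0 := by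
  have hp : (Polynomial.C c3 * Polynomial.X ^ 3 + Polynomial.C c2 * Polynomial.X ^ 2
      + Polynomial.C c1 * Polynomial.X + Polynomial.C c0 : Polynomial k) = 0 := by
    apply Polynomial.funext
    intro s
    simp only [Polynomial.eval_add, Polynomial.eval_mul, Polynomial.eval_C, Polynomial.eval_pow,
      Polynomial.eval_X, Polynomial.eval_zero]
    linear_combination h s
  have h' := Polynomial.ext_iff.1 hp
  refine ⟨?_, ?_, ?_, ?_⟩
  · simpa [Polynomial.coeff_X, Polynomial.coeff_C] using h' 0
  · simpa [Polynomial.coeff_X, Polynomial.coeff_C, Polynomial.coeff_X_pow] using h' 1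
  · simpa [Polynomial.coeff_X, Polynomial.coeff_C, Polynomial.coeff_X_pow] using h' 2
  · simpa [Polynomial.coeff_X, Polynomial.coeff_C, Polynomial.coeff_X_pow] using h' 3

/-- Binary quadratic forms factor over an algebraically closed field. -/
lemma binary_factor [IsAlgClosed k] (a b c : k) :
    ∃ l1 l2 m1 m2 : k, a = l1 * m1 ∧ b = l1 * m2 + l2 * m1 ∧ c = l2 * m2 := by
  by_cases ha : a = 0
  · exact ⟨0, 1, b, c, by simp [ha], by simp, by simp⟩
  · -- a (x - α y)(x - β y)
    have hdeg : (Polynomial.C a * Polynomial.X ^ 2 + Polynomial.C b * Polynomial.X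
        + Polynomial.C c : Polynomial k).degree ≠ 0 := by
      rw [Polynomial.degree_quadratic ha]; decide
    obtain ⟨α, hα⟩ := IsAlgClosed.exists_root _ hdeg
    have hα' : a * α ^ 2 + b * α + c = 0 := by simpa [Polynomial.IsRoot] using hα
    refine ⟨1, -α, a, a * α + b, by ring, by ring, ?_⟩
    linear_combination hα'

lemma binary_zero [IsAlgClosed k] (a b c : k) :
    ∃ x y : k, (x ≠ 0 ∨ y ≠ 0) ∧ a * x ^ 2 + b * (x * y) + c * y ^ 2 = 0 := by
  obtain ⟨l1, l2, m1, m2, rfl, rfl, rfl⟩ := binary_factor a b c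
  by_cases h : l1 = 0 ∧ l2 = 0
  · exact ⟨1, 0, by simp, by simp [h.1, h.2]⟩
  · refine ⟨l2, -l1, ?_, by ring⟩
    by_contra hcon
    push Not at hcon
    exact h ⟨by simpa using hcon.2, hcon.1⟩

/-- The (half-)discriminant of a ternary quadratic form. -/
def disc (a b c d e g : k) : k :=
  4 * a * c * g + b * d * e - a * e ^ 2 - b ^ 2 * g - c * d ^ 2

/-- A conic with zero half-discriminant is a product of two linear forms
(in every characteristic). -/
lemma conic_factor [IsAlgClosed k] (a b c d e g : k) (h : disc a b c d e g = 0) :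
    ∃ l1 l2 l3 m1 m2 m3 : k, a = l1 * m1 ∧ b = l1 * m2 + l2 * m1 ∧ c = l2 * m2 ∧
      d = l1 * m3 + l3 * m1 ∧ e = l2 * m3 + l3 * m2 ∧ g = l3 * m3 := by
  obtain ⟨l1, l2, m1, m2, rfl, rfl, rfl⟩ := binary_factor a b c
  unfold disc at h
  by_cases hdet : l1 * m2 - l2 * m1 = 0
  · by_cases hl : l1 = 0 ∧ l2 = 0
    · exact ⟨0, 0, 1, d, e, g, by simp [hl.1], by simp [hl.1, hl.2], by simp [hl.2],
        by simp, by simp, by simp⟩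
    by_cases hm : m1 = 0 ∧ m2 = 0
    · exact ⟨0, 0, 1, d, e, g, by simp [hm.1], by simp [hm.1, hm.2], by simp [hm.2],
        by simp, by simp, by simp⟩
    obtain ⟨κ, hκ1, hκ2⟩ : ∃ κ, m1 = κ * l1 ∧ m2 = κ * l2 := by
      by_cases h1 : l1 = 0
      · have h2 : l2 ≠ 0 := fun h2 => hl ⟨h1, h2⟩
        refine ⟨m2 / l2, ?_, by field_simp⟩
        subst h1
        have : l2 * m1 = 0 := by linear_combination -hdet
        simpa [h2] using this
      · refine ⟨m1 / l1, by field_simp, ?_⟩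
        field_simp
        linear_combination hdet
    subst hκ1 hκ2
    have hκ : κ ≠ 0 := by
      rintro rfl
      exact hm ⟨by simp, by simp⟩
    have h2 : κ * (l1 * e - l2 * d) ^ 2 = 0 := by linear_combination -h
    have h3 : l1 * e - l2 * d = 0 := by simpa [hκ] using h2
    obtain ⟨ρ, hd, he⟩ : ∃ ρ, d = ρ * l1 ∧ e = ρ * l2 := by
      by_cases h1 : l1 = 0
      · have h8 : l2 ≠ 0 := fun h8 => hl ⟨h1, h8⟩
        refine ⟨e / l2, ?_, by field_simp⟩
        subst h1
        have h7 : l2 * d = 0 := by linear_combination -h3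
        rw [mul_zero]
        exact (mul_eq_zero.1 h7).resolve_left h8
      · refine ⟨d / l1, by field_simp, ?_⟩
        field_simp
        linear_combination h3
    subst hd he
    obtain ⟨a1, a2, b1, b2, h4, h5, h6⟩ := binary_factor κ ρ g
    refine ⟨a1 * l1, a1 * l2, a2, b1 * l1, b1 * l2, b2, ?_, ?_, ?_, ?_, ?_, ?_⟩
    · rw [h4]; ring
    · rw [h4]; ring
    · rw [h4]; ring
    · rw [h5]; ring
    · rw [h5]; ring
    · rw [h6]
  · -- solve the linear system for l3, m3
    set δ := l1 * m2 - l2 * m1 with hδ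
    have hd : d = l1 * ((d * m2 - e * m1) / δ) + ((l1 * e - l2 * d) / δ) * m1 := by
      field_simp
      rw [hδ]; ring
    have he : e = l2 * ((d * m2 - e * m1) / δ) + ((l1 * e - l2 * d) / δ) * m2 := by
      field_simp
      rw [hδ]; ring
    refine ⟨l1, l2, (l1 * e - l2 * d) / δ, m1, m2, (d * m2 - e * m1) / δ,
      rfl, rfl, rfl, hd, he, ?_⟩
    field_simp
    rw [hδ]
    linear_combination -h

/-- If a conic contains the line through `(x0, y0, 0)` and `(x1, y1, 1)` then its
half-discriminant vanishes. -/
lemma disc_eq_zero_of_line {a b c d e g x0 y0 x1 y1 : k} (h0 : x0 ≠ 0 ∨ y0 ≠ 0)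
    (h1 : a * x0 ^ 2 + b * x0 * y0 + c * y0 ^ 2 = 0)
    (h2 : (2 * a * x1 + b * y1 + d) * x0 + (b * x1 + 2 * c * y1 + e) * y0 = 0)
    (h3 : a * x1 ^ 2 + b * x1 * y1 + c * y1 ^ 2 + d * x1 + e * y1 + g = 0) :
    disc a b c d e g = 0 := by
  unfold disc
  obtain ⟨d', hd⟩ : ∃ d', d' = 2 * a * x1 + b * y1 + d := ⟨_, rfl⟩
  obtain ⟨e', he⟩ : ∃ e', e' = b * x1 + 2 * c * y1 + e := ⟨_, rfl⟩
  rw [← hd, ← he] at h2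
  have hg : g = -(a * x1 ^ 2 + b * x1 * y1 + c * y1 ^ 2 + d * x1 + e * y1) := by
    linear_combination h3
  have hd2 : d = d' - (2 * a * x1 + b * y1) := by rw [hd]; ring
  have he2 : e = e' - (b * x1 + 2 * c * y1) := by rw [he]; ring
  have key : 4 * a * c * g + b * d * e - a * e ^ 2 - b ^ 2 * g - c * d ^ 2
      = b * d' * e' - a * e' ^ 2 - c * d' ^ 2 := by
    rw [hg, hd2, he2]; ring
  rw [key]
  rcases h0 with h0 | h0
  · have : x0 ^ 2 * (b * d' * e' - a * e' ^ 2 - c * d' ^ 2) = 0 := by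
      linear_combination (-e' ^ 2) * h1 + (b * e' * x0 - c * (d' * x0 - e' * y0)) * h2
    simpa [h0] using this
  · have : y0 ^ 2 * (b * d' * e' - a * e' ^ 2 - c * d' ^ 2) = 0 := by
      linear_combination (-d' ^ 2) * h1 + (b * d' * y0 - a * (e' * y0 - d' * x0)) * h2
    simpa [h0] using this

end Alg
end Cubic27

namespace Cubic27

section Tri
variable {k : Type*} [Field k] {V : Type*} [AddCommGroup V] [Module k V]

/-- The differential of the cubic form `v ↦ T v v v` at `v` in direction `w`. -/
def dT (T : V →ₗ[k] V →ₗ[k] V →ₗ[k] k) (v w : V) : k := T w v v + T v w v + T v v w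

/-- The full polarization of the cubic form `v ↦ T v v v`. -/
def pT (T : V →ₗ[k] V →ₗ[k] V →ₗ[k] k) (u v w : V) : k :=
  T u v w + T u w v + T v u w + T v w u + T w u v + T w v u

/-- Smoothness of the cubic form `v ↦ T v v v`. -/
def Smooth (T : V →ₗ[k] V →ₗ[k] V →ₗ[k] k) : Prop :=
  ∀ v : V, v ≠ 0 → T v v v = 0 → ∃ w, dT T v w ≠ 0

/-- `W` is a line on the cubic surface. -/
def IsLine (T : V →ₗ[k] V →ₗ[k] V →ₗ[k] k) (W : Submodule k V) : Prop :=
  Module.finrank k W = 2 ∧ ∀ v ∈ W, T v v v = 0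

variable (T : V →ₗ[k] V →ₗ[k] V →ₗ[k] k)

lemma dT_add_right (v w w' : V) : dT T v (w + w') = dT T v w + dT T v w' := by
  simp only [dT, map_add, LinearMap.add_apply]; ring

lemma dT_smul_right (v w : V) (s : k) : dT T v (s • w) = s * dT T v w := by
  simp only [dT, map_smul, LinearMap.smul_apply, smul_eq_mul]; ring

lemma dT_comb (a b n : V) (x y : k) :
    dT T (x • a + y • b) n = dT T a n * x ^ 2 + pT T a b n * (x * y) + dT T b n * y ^ 2 := by
  simp only [dT, pT, map_add, map_smul, LinearMap.add_apply, LinearMap.smul_apply, smul_eq_mul]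
  ring

lemma T_add_smul (v w : V) (s : k) :
    T (v + s • w) (v + s • w) (v + s • w)
      = T v v v + dT T v w * s + dT T w v * s ^ 2 + T w w w * s ^ 3 := by
  simp only [dT, map_add, map_smul, LinearMap.add_apply, LinearMap.smul_apply, smul_eq_mul]
  ring

/-- The cubic form vanishes on the span of `a`, `b` : the four coefficients vanish. -/
lemma coeffs_of_vanish [Infinite k] {a b : V}
    (h : ∀ s : k, T (a + s • b) (a + s • b) (a + s • b) = 0) :
    T a a a = 0 ∧ dT T a b = 0 ∧ dT T b a = 0 ∧ T b b b = 0 := by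
  apply cubic_coeffs_zero
  intro s
  rw [← T_add_smul]
  exact h s

lemma IsLine.coeffs [Infinite k] {W : Submodule k V} (hW : IsLine T W) {a b : V}
    (ha : a ∈ W) (hb : b ∈ W) :
    T a a a = 0 ∧ dT T a b = 0 ∧ dT T b a = 0 ∧ T b b b = 0 :=
  coeffs_of_vanish T fun s => hW.2 _ (W.add_mem ha (W.smul_mem s hb))

/-- Two independent vectors in a subspace of dimension at least two. -/
lemma exists_pair {W : Submodule k V} [FiniteDimensional k V] (h : 2 ≤ Module.finrank k W) :
    ∃ a ∈ W, ∃ b ∈ W, ∀ x y : k, x • a + y • b = 0 → x = 0 ∧ y = 0 := by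
  obtain ⟨f, hf⟩ := exists_linearIndependent_of_le_finrank (R := k) (M := W) h
  refine ⟨f 0, (f 0).2, f 1, (f 1).2, fun x y hxy => ?_⟩
  have := LinearIndependent.pair_iff.1 (show LinearIndependent k ![f 0, f 1] by
    convert hf using 1; ext i; fin_cases i <;> rfl) x y
  apply this
  apply Subtype.ext
  simpa using hxy

lemma finrank_inf_ker_ge [FiniteDimensional k V] (P : Submodule k V) (L : V →ₗ[k] k) :
    Module.finrank k P ≤ Module.finrank k (P ⊓ LinearMap.ker L : Submodule k V) + 1 := by
  have h1 := LinearMap.finrank_range_add_finrank_ker (L.domRestrict P)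
  have h2 : Module.finrank k (LinearMap.range (L.domRestrict P)) ≤ 1 := by
    simpa using Submodule.finrank_le (LinearMap.range (L.domRestrict P))
  have h3 : Module.finrank k (LinearMap.ker (L.domRestrict P))
      = Module.finrank k (P ⊓ LinearMap.ker L : Submodule k V) := by
    have : (LinearMap.ker (L.domRestrict P)).map P.subtype = P ⊓ LinearMap.ker L := by
      ext v
      simp only [Submodule.mem_map, LinearMap.mem_ker, Submodule.mem_inf]
      constructor
      · rintro ⟨w, hw, rfl⟩
        exact ⟨w.2, hw⟩
      · rintro ⟨hv, hL⟩
        exact ⟨⟨v, hv⟩, hL, rfl⟩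
    rw [← this]
    exact (Submodule.finrank_map_subtype_eq P _).symm
  omega

lemma finrank_inf_ker_eq [FiniteDimensional k V] (P : Submodule k V) (L : V →ₗ[k] k)
    {u : V} (hu : u ∈ P) (hL : L u ≠ 0) :
    Module.finrank k P = Module.finrank k (P ⊓ LinearMap.ker L : Submodule k V) + 1 := by
  have h1 := finrank_inf_ker_ge P L
  have h2 : P ⊓ LinearMap.ker L < P := by
    refine lt_of_le_of_ne inf_le_left fun h => hL ?_
    rw [← h] at hu
    exact hu.2
  have := Submodule.finrank_lt_finrank_of_lt h2
  omega

variable {T}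

/-- A plane section of a smooth cubic surface has no double line. -/
lemma no_double [IsAlgClosed k] [FiniteDimensional k V] (hV : Module.finrank k V = 4)
    (hT : Smooth T) {P : Submodule k V} (hP : Module.finrank k P = 3) (L M : V →ₗ[k] k)
    (h : ∀ v ∈ P, T v v v = L v ^ 2 * M v) : False := by
  have : Infinite k := IsAlgClosed.instInfinite
  have h1 := finrank_inf_ker_ge P L
  obtain ⟨a, ha, b, hb, hab⟩ := exists_pair (W := P ⊓ LinearMap.ker L) (by omega)
  obtain ⟨n, hn⟩ : ∃ n, n ∉ P := by
    by_contra hcon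
    push Not at hcon
    have : P = ⊤ := by ext; simp [hcon]
    rw [this, finrank_top] at hP
    omega
  obtain ⟨x, y, hxy, h0⟩ := binary_zero (dT T a n) (pT T a b n) (dT T b n)
  have hvm : x • a + y • b ∈ P ⊓ LinearMap.ker L :=
    Submodule.add_mem _ (Submodule.smul_mem _ _ ha) (Submodule.smul_mem _ _ hb)
  have hvn : dT T (x • a + y • b) n = 0 := by rw [dT_comb, h0]
  have hv0 : x • a + y • b ≠ 0 := by
    intro hcon
    obtain ⟨hx, hy⟩ := hab x y hcon
    simp [hx, hy] at hxy
  generalize x • a + y • b = v at hvm hvn hv0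
  have hLv : L v = 0 := hvm.2
  have hvP : v ∈ P := hvm.1
  have hTv : T v v v = 0 := by rw [h v hvP, hLv]; ring
  obtain ⟨w, hw⟩ := hT v hv0 hTv
  have hdP : ∀ w ∈ P, dT T v w = 0 := by
    intro w hw
    refine (cubic_coeffs_zero (c0 := T v v v) (c1 := dT T v w)
      (c2 := dT T w v - L w ^ 2 * M v) (c3 := T w w w - L w ^ 2 * M w) fun s => ?_).2.1
    have h2 := h (v + s • w) (P.add_mem hvP (P.smul_mem s hw))
    rw [T_add_smul] at h2
    simp only [map_add, map_smul, hLv, smul_eq_mul] at h2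
    linear_combination h2
  have htop : P ⊔ Submodule.span k {n} = ⊤ := by
    apply Submodule.eq_top_of_finrank_eq
    have h3 : P < P ⊔ Submodule.span k {n} := by
      refine lt_of_le_of_ne le_sup_left fun hcon => hn ?_
      rw [hcon]
      exact Submodule.mem_sup_right (Submodule.mem_span_singleton_self n)
    have h4 := Submodule.finrank_lt_finrank_of_lt h3
    have h5 := Submodule.finrank_le (P ⊔ Submodule.span k {n})
    omega
  have hwt : w ∈ P ⊔ Submodule.span k {n} := by rw [htop]; trivial
  obtain ⟨w1, hw1, w2, hw2, rfl⟩ := Submodule.mem_sup.1 hwt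
  obtain ⟨s, rfl⟩ := Submodule.mem_span_singleton.1 hw2
  apply hw
  rw [dT_add_right, dT_smul_right, hvn, hdP w1 hw1]
  ring

/-- In a triple-line plane section each of the linear forms is nonzero on the plane. -/
lemma triple_ne_zero [IsAlgClosed k] [FiniteDimensional k V] (hV : Module.finrank k V = 4)
    (hT : Smooth T) {P : Submodule k V} (hP : Module.finrank k P = 3) (N L M : V →ₗ[k] k)
    (h : ∀ v ∈ P, T v v v = N v * L v * M v) : ∃ u ∈ P, N u ≠ 0 := by
  by_contra hcon
  push Not at hcon
  refine no_double hV hT hP N 0 fun v hv => ?_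
  rw [h v hv, hcon v hv]
  simp

lemma triple_isLine [IsAlgClosed k] [FiniteDimensional k V] (hV : Module.finrank k V = 4)
    (hT : Smooth T) {P : Submodule k V} (hP : Module.finrank k P = 3) (N L M : V →ₗ[k] k)
    (h : ∀ v ∈ P, T v v v = N v * L v * M v) : IsLine T (P ⊓ LinearMap.ker N) := by
  obtain ⟨u, hu, hN⟩ := triple_ne_zero hV hT hP N L M h
  have h1 := finrank_inf_ker_eq P N hu hN
  refine ⟨by omega, fun v hv => ?_⟩
  have h2 : N v = 0 := hv.2
  rw [h v hv.1, h2]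
  ring

lemma triple_distinct [IsAlgClosed k] [FiniteDimensional k V] (hV : Module.finrank k V = 4)
    (hT : Smooth T) {P : Submodule k V} (hP : Module.finrank k P = 3) (N L M : V →ₗ[k] k)
    (h : ∀ v ∈ P, T v v v = N v * L v * M v) :
    P ⊓ LinearMap.ker N ≠ P ⊓ LinearMap.ker L := by
  intro hcon
  obtain ⟨u, hu, hN⟩ := triple_ne_zero hV hT hP N L M h
  have key : ∀ v ∈ P, L v = (L u / N u) * N v := by
    intro v hv
    have h1 : v - (N v / N u) • u ∈ P ⊓ LinearMap.ker N := by
      refine ⟨P.sub_mem hv (P.smul_mem _ hu), ?_⟩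
      simp [hN]
    rw [hcon] at h1
    have h2 : L (v - (N v / N u) • u) = 0 := h1.2
    simp only [map_sub, map_smul, smul_eq_mul] at h2
    field_simp at h2 ⊢
    linear_combination h2
  refine no_double hV hT hP N ((L u / N u) • M) fun v hv => ?_
  rw [h v hv, key v hv]
  simp only [LinearMap.smul_apply, smul_eq_mul]
  ring

lemma triple_lines [IsAlgClosed k] [FiniteDimensional k V] (hV : Module.finrank k V = 4)
    (hT : Smooth T) {P : Submodule k V} (hP : Module.finrank k P = 3) (N L M : V →ₗ[k] k)
    (h : ∀ v ∈ P, T v v v = N v * L v * M v) {W : Submodule k V} (hW : IsLine T W)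
    (hWP : W ≤ P) : W = P ⊓ LinearMap.ker N ∨ W = P ⊓ LinearMap.ker L ∨
      W = P ⊓ LinearMap.ker M := by
  have : Infinite k := IsAlgClosed.instInfinite
  have hN := triple_isLine hV hT hP N L M h
  have hL := triple_isLine hV hT hP L N M (fun v hv => by rw [h v hv]; ring)
  have hM := triple_isLine hV hT hP M L N (fun v hv => by rw [h v hv]; ring)
  have aux : ∀ K : V →ₗ[k] k, IsLine T (P ⊓ LinearMap.ker K) → (∀ v ∈ W, K v = 0) →
      W = P ⊓ LinearMap.ker K := by
    intro K hK hz
    apply Submodule.eq_of_le_of_finrank_eq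
    · exact fun v hv => ⟨hWP hv, hz v hv⟩
    · rw [hW.1, hK.1]
  by_contra hcon
  push Not at hcon
  have e1 : ∃ x ∈ W, N x ≠ 0 := by
    by_contra h'; push Not at h'; exact hcon.1 (aux N hN h')
  have e2 : ∃ x ∈ W, L x ≠ 0 := by
    by_contra h'; push Not at h'; exact hcon.2.1 (aux L hL h')
  have e3 : ∃ x ∈ W, M x ≠ 0 := by
    by_contra h'; push Not at h'; exact hcon.2.2 (aux M hM h')
  obtain ⟨x, hx, hx'⟩ := Module.Dual.exists_forall_mem_ne_zero_of_forall_exists W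
    (f := (![N, L, M] : Fin 3 → Module.Dual k V)) (by
      intro i; fin_cases i
      · exact e1
      · exact e2
      · exact e3)
  have h1 := hW.2 x hx
  rw [h x (hWP hx)] at h1
  have n0 : N x ≠ 0 := hx' 0
  have n1 : L x ≠ 0 := hx' 1
  have n2 : M x ≠ 0 := hx' 2
  exact mul_ne_zero (mul_ne_zero n0 n1) n2 h1

end Tri
end Cubic27

namespace Cubic27

section Fiber
variable {k : Type*} [Field k] {V : Type*} [AddCommGroup V] [Module k V]
variable {T : V →ₗ[k] V →ₗ[k] V →ₗ[k] k}

/-- The discriminant of the residual conic in the plane spanned by the line `p, q` and `u`. -/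
def Disc (T : V →ₗ[k] V →ₗ[k] V →ₗ[k] k) (p q u : V) : k :=
  disc (dT T p u) (pT T p q u) (dT T q u) (dT T u p) (dT T u q) (T u u u)

lemma expand_plane {p q : V} (h1 : T p p p = 0) (h2 : dT T p q = 0) (h3 : dT T q p = 0)
    (h4 : T q q q = 0) (u : V) (x y w : k) :
    T (x • p + y • q + w • u) (x • p + y • q + w • u) (x • p + y • q + w • u)
      = w * (dT T p u * x ^ 2 + pT T p q u * x * y + dT T q u * y ^ 2
        + dT T u p * x * w + dT T u q * y * w + T u u u * w ^ 2) := by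
  simp only [dT, pT, map_add, map_smul, LinearMap.add_apply, LinearMap.smul_apply,
    smul_eq_mul] at *
  linear_combination x ^ 3 * h1 + x ^ 2 * y * h2 + x * y ^ 2 * h3 + y ^ 3 * h4

lemma Disc_eq_zero_aux {p q : V} (h1 : T p p p = 0) (h2 : dT T p q = 0)
    (h3 : dT T q p = 0) (h4 : T q q q = 0) (u : V) {x0 y0 x1 y1 : k} (h0 : x0 ≠ 0 ∨ y0 ≠ 0)
    (e1 : dT T (x0 • p + y0 • q) (x1 • p + y1 • q + u) = 0)
    (e2 : dT T (x1 • p + y1 • q + u) (x0 • p + y0 • q) = 0)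
    (e3 : T (x1 • p + y1 • q + u) (x1 • p + y1 • q + u) (x1 • p + y1 • q + u) = 0) :
    Disc T p q u = 0 := by
  apply disc_eq_zero_of_line (x0 := x0) (y0 := y0) (x1 := x1) (y1 := y1) h0
  · simp only [dT, pT, map_add, map_smul, LinearMap.add_apply, LinearMap.smul_apply,
      smul_eq_mul] at *
    linear_combination e1 - 3 * x1 * x0 ^ 2 * h1 - (x0 ^ 2 * y1 + 2 * x0 * y0 * x1) * h2
      - (2 * x0 * y0 * y1 + y0 ^ 2 * x1) * h3 - 3 * y0 ^ 2 * y1 * h4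
  · simp only [dT, pT, map_add, map_smul, LinearMap.add_apply, LinearMap.smul_apply,
      smul_eq_mul] at *
    linear_combination e2 - 3 * x0 * x1 ^ 2 * h1 - (x1 ^ 2 * y0 + 2 * x1 * y1 * x0) * h2
      - (2 * x1 * y1 * y0 + y1 ^ 2 * x0) * h3 - 3 * y1 ^ 2 * y0 * h4
  · have := expand_plane h1 h2 h3 h4 u x1 y1 1
    rw [one_smul, e3] at this
    linear_combination -this

/-- If the plane through `ℓ` and `u` contains another line, the discriminant vanishes. -/
lemma Disc_eq_zero [Infinite k] [FiniteDimensional k V] {ℓ m : Submodule k V}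
    (hℓ : IsLine T ℓ) (hm : IsLine T m) (hne : m ≠ ℓ) {p q u : V} (hp : p ∈ ℓ) (hq : q ∈ ℓ)
    (hspan : ∀ v ∈ m, ∃ x y w : k, v = x • p + y • q + w • u) : Disc T p q u = 0 := by
  obtain ⟨h1, h2, h3, h4⟩ := hℓ.coeffs T hp hq
  -- a vector outside of ℓ
  obtain ⟨v1, hv1, hv1'⟩ : ∃ v ∈ m, v ∉ ℓ := by
    by_contra hcon
    push Not at hcon
    exact hne (Submodule.eq_of_le_of_finrank_eq hcon (by rw [hm.1, hℓ.1]))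
  obtain ⟨x1, y1, w1, e1⟩ := hspan v1 hv1
  have hw1 : w1 ≠ 0 := by
    rintro rfl
    apply hv1'
    rw [e1, zero_smul, add_zero]
    exact ℓ.add_mem (ℓ.smul_mem _ hp) (ℓ.smul_mem _ hq)
  obtain ⟨a, ha, b, hb, hab⟩ := exists_pair (W := m) hm.1.ge
  obtain ⟨xa, ya, wa, ea⟩ := hspan a ha
  obtain ⟨xb, yb, wb, eb⟩ := hspan b hb
  obtain ⟨c, d, hcd, hw⟩ : ∃ c d : k, (c ≠ 0 ∨ d ≠ 0) ∧ c * wa + d * wb = 0 := by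
    by_cases h : wa = 0
    · exact ⟨1, 0, by simp, by simp [h]⟩
    · exact ⟨-wb, wa, Or.inr h, by ring⟩
  have hv0 : c • a + d • b ∈ m := m.add_mem (m.smul_mem _ ha) (m.smul_mem _ hb)
  have hv0ne : c • a + d • b ≠ 0 := by
    intro h
    obtain ⟨hc, hd⟩ := hab c d h
    simp [hc, hd] at hcd
  have ev0 : c • a + d • b = (c * xa + d * xb) • p + (c * ya + d * yb) • q := by
    have : c • a + d • b = (c * xa + d * xb) • p + (c * ya + d * yb) • q
        + (c * wa + d * wb) • u := by
      rw [ea, eb]; module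
    rw [this, hw, zero_smul, add_zero]
  have ev1 : w1⁻¹ • v1 = (w1⁻¹ * x1) • p + (w1⁻¹ * y1) • q + u := by
    have : w1⁻¹ • v1 = (w1⁻¹ * x1) • p + (w1⁻¹ * y1) • q + (w1⁻¹ * w1) • u := by
      rw [e1]; module
    rw [this, inv_mul_cancel₀ hw1, one_smul]
  obtain ⟨g1, g2, g3, g4⟩ := hm.coeffs T hv0 (m.smul_mem w1⁻¹ hv1)
  rw [ev0, ev1] at g2 g3
  rw [ev1] at g4
  refine Disc_eq_zero_aux h1 h2 h3 h4 u ?_ g2 g3 g4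
  by_contra hcon
  push Not at hcon
  apply hv0ne
  rw [ev0, hcon.1, hcon.2]
  simp

lemma basis_expand (b : Module.Basis (Fin 4) k V) (v : V) :
    v = b.coord 0 v • b 0 + b.coord 1 v • b 1 + b.coord 2 v • b 2 + b.coord 3 v • b 3 := by
  have h := b.sum_repr v
  rw [Fin.sum_univ_four] at h
  exact h.symm

/-- The plane `t = τ z`. -/
noncomputable def plane (b : Module.Basis (Fin 4) k V) (τ : k) : Submodule k V :=
  LinearMap.ker (b.coord 3 - τ • b.coord 2)

lemma mem_plane (b : Module.Basis (Fin 4) k V) (τ : k) (v : V) :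
    v ∈ plane b τ ↔ b.coord 3 v = τ * b.coord 2 v := by
  simp [plane, sub_eq_zero]

lemma plane_expand (b : Module.Basis (Fin 4) k V) {τ : k} {v : V} (hv : v ∈ plane b τ) :
    v = b.coord 0 v • b 0 + b.coord 1 v • b 1 + b.coord 2 v • (b 2 + τ • b 3) := by
  conv_lhs => rw [basis_expand b v]
  rw [(mem_plane b τ v).1 hv]
  module

lemma finrank_plane [FiniteDimensional k V] (b : Module.Basis (Fin 4) k V) (τ : k) :
    Module.finrank k (plane b τ) = 3 := by
  have hV : Module.finrank k V = 4 := by simp [Module.finrank_eq_card_basis b]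
  have := finrank_inf_ker_eq ⊤ (b.coord 3 - τ • b.coord 2) (u := b 3) trivial
    (by simp)
  rw [finrank_top, hV, top_inf_eq] at this
  change Module.finrank k (LinearMap.ker (b.coord 3 - τ • b.coord 2)) = 3
  omega

lemma line_eq [FiniteDimensional k V] {ℓ : Submodule k V} (hℓ : IsLine T ℓ)
    (b : Module.Basis (Fin 4) k V) (h0 : b 0 ∈ ℓ) (h1 : b 1 ∈ ℓ) {v : V} :
    v ∈ ℓ ↔ b.coord 2 v = 0 ∧ b.coord 3 v = 0 := by
  have hV : Module.finrank k V = 4 := by simp [Module.finrank_eq_card_basis b]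
  have e1 := finrank_inf_ker_eq ⊤ (b.coord 2) (u := b 2) trivial (by simp)
  rw [finrank_top, hV, top_inf_eq] at e1
  have e2 := finrank_inf_ker_eq (LinearMap.ker (b.coord 2)) (b.coord 3) (u := b 3)
    (by simp) (by simp)
  have : LinearMap.ker (b.coord 2) ⊓ LinearMap.ker (b.coord 3) = ℓ := by
    apply Submodule.eq_of_le_of_finrank_eq
    · rintro v ⟨hv2, hv3⟩
      rw [SetLike.mem_coe, LinearMap.mem_ker] at hv2 hv3
      rw [basis_expand b v, hv2, hv3, zero_smul, zero_smul, add_zero, add_zero]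
      exact ℓ.add_mem (ℓ.smul_mem _ h0) (ℓ.smul_mem _ h1)
    · rw [hℓ.1]; omega
  rw [← this]
  simp

/-- Derivative of the discriminant. -/
def ddisc (a b c d e g a' b' c' d' e' g' : k) : k :=
  4 * a' * c * g + 4 * a * c' * g + 4 * a * c * g' + b' * d * e + b * d' * e + b * d * e'
  - a' * e ^ 2 - 2 * a * e * e' - 2 * b * b' * g - b ^ 2 * g' - c' * d ^ 2 - 2 * c * d * d'

lemma ddisc_product (l1 l2 l3 m1 m2 m3 a' b' c' d' e' g' : k) :
    ddisc (l1 * m1) (l1 * m2 + l2 * m1) (l2 * m2) (l1 * m3 + l3 * m1) (l2 * m3 + l3 * m2)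
      (l3 * m3) a' b' c' d' e' g'
    = -(a' * (l2 * m3 - l3 * m2) ^ 2 + b' * (l2 * m3 - l3 * m2) * (l3 * m1 - l1 * m3)
      + c' * (l3 * m1 - l1 * m3) ^ 2 + d' * (l2 * m3 - l3 * m2) * (l1 * m2 - l2 * m1)
      + e' * (l3 * m1 - l1 * m3) * (l1 * m2 - l2 * m1) + g' * (l1 * m2 - l2 * m1) ^ 2) := by
  unfold ddisc; ring

lemma dT_comb3 (p q u s : V) (x y z : k) :
    dT T (x • p + y • q + z • u) s = dT T p s * x ^ 2 + pT T p q s * x * y + dT T q s * y ^ 2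
      + pT T p u s * x * z + pT T q u s * y * z + dT T u s * z ^ 2 := by
  simp only [dT, pT, map_add, map_smul, LinearMap.add_apply, LinearMap.smul_apply, smul_eq_mul]
  ring

/-- At a zero of the discriminant, the plane section splits into three lines and the zero is
simple. -/
lemma fiber_split [IsAlgClosed k] [FiniteDimensional k V] (hT : Smooth T)
    {ℓ : Submodule k V} (hℓ : IsLine T ℓ)
    (b : Module.Basis (Fin 4) k V) (h0 : b 0 ∈ ℓ) (h1 : b 1 ∈ ℓ) (τ : k)
    (hd : Disc T (b 0) (b 1) (b 2 + τ • b 3) = 0) :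
    (∃ L M : V →ₗ[k] k, ∀ v ∈ plane b τ, T v v v = b.coord 2 v * L v * M v) ∧
    ddisc (dT T (b 0) (b 2 + τ • b 3)) (pT T (b 0) (b 1) (b 2 + τ • b 3))
      (dT T (b 1) (b 2 + τ • b 3)) (dT T (b 2 + τ • b 3) (b 0)) (dT T (b 2 + τ • b 3) (b 1))
      (T (b 2 + τ • b 3) (b 2 + τ • b 3) (b 2 + τ • b 3))
      (dT T (b 0) (b 3)) (pT T (b 0) (b 1) (b 3)) (dT T (b 1) (b 3))
      (pT T (b 0) (b 2 + τ • b 3) (b 3)) (pT T (b 1) (b 2 + τ • b 3) (b 3))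
      (dT T (b 2 + τ • b 3) (b 3)) ≠ 0 := by
  have : Infinite k := IsAlgClosed.instInfinite
  have hV : Module.finrank k V = 4 := by simp [Module.finrank_eq_card_basis b]
  obtain ⟨z1, z2, z3, z4⟩ := hℓ.coeffs T h0 h1
  obtain ⟨l1, l2, l3, m1, m2, m3, ea, eb, ec, ed, ee, eg⟩ := conic_factor _ _ _ _ _ _ hd
  have hP := finrank_plane b τ
  let L : V →ₗ[k] k := l1 • b.coord 0 + l2 • b.coord 1 + l3 • b.coord 2
  let M : V →ₗ[k] k := m1 • b.coord 0 + m2 • b.coord 1 + m3 • b.coord 2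
  have hL : ∀ v, L v = l1 * b.coord 0 v + l2 * b.coord 1 v + l3 * b.coord 2 v := fun v => by
    simp [L]
  have hM : ∀ v, M v = m1 * b.coord 0 v + m2 * b.coord 1 v + m3 * b.coord 2 v := fun v => by
    simp [M]
  have hNLM : ∀ v ∈ plane b τ, T v v v = b.coord 2 v * L v * M v := by
    intro v hv
    rw [hL, hM]
    have e := expand_plane z1 z2 z3 z4 (b 2 + τ • b 3) (b.coord 0 v) (b.coord 1 v) (b.coord 2 v)
    rw [← plane_expand b hv, ea, eb, ec, ed, ee, eg] at e
    rw [e]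
    ring
  refine ⟨⟨L, M, hNLM⟩, ?_⟩
  have hLne := triple_ne_zero hV hT hP L M (b.coord 2) (fun v hv => by rw [hNLM v hv]; ring)
  have hMne := triple_ne_zero hV hT hP M L (b.coord 2) (fun v hv => by rw [hNLM v hv]; ring)
  have hLM := triple_distinct hV hT hP L M (b.coord 2) (fun v hv => by rw [hNLM v hv]; ring)
  obtain ⟨n1, hn1⟩ : ∃ n1, n1 = l2 * m3 - l3 * m2 := ⟨_, rfl⟩
  obtain ⟨n2, hn2⟩ : ∃ n2, n2 = l3 * m1 - l1 * m3 := ⟨_, rfl⟩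
  obtain ⟨n3, hn3⟩ : ∃ n3, n3 = l1 * m2 - l2 * m1 := ⟨_, rfl⟩
  -- the singular point of the conic is nonzero
  have hn : ¬ (n1 = 0 ∧ n2 = 0 ∧ n3 = 0) := by
    rintro ⟨r1, r2, r3⟩
    have i1 : ∀ v, l1 * M v = m1 * L v := fun v => by
      rw [hL, hM]
      linear_combination (-b.coord 1 v) * (hn3.symm.trans r3) * (-1)
        - b.coord 2 v * (hn2.symm.trans r2)
    have i2 : ∀ v, l2 * M v = m2 * L v := fun v => by
      rw [hL, hM]
      linear_combination (-b.coord 0 v) * (hn3.symm.trans r3)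
        + b.coord 2 v * (hn1.symm.trans r1)
    have i3 : ∀ v, l3 * M v = m3 * L v := fun v => by
      rw [hL, hM]
      linear_combination (b.coord 0 v) * (hn2.symm.trans r2)
        - b.coord 1 v * (hn1.symm.trans r1)
    apply hLM
    apply le_antisymm
    · rintro v ⟨hvP, hv⟩
      refine ⟨hvP, ?_⟩
      have hv' : L v = 0 := hv
      change M v = 0
      by_contra hMv
      obtain ⟨u, -, hu⟩ := hLne
      apply hu
      have j1 := i1 v
      have j2 := i2 v
      have j3 := i3 v
      rw [hv', mul_zero] at j1 j2 j3
      rw [hL, (mul_eq_zero.1 j1).resolve_right hMv, (mul_eq_zero.1 j2).resolve_right hMv,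
        (mul_eq_zero.1 j3).resolve_right hMv]
      ring
    · rintro v ⟨hvP, hv⟩
      refine ⟨hvP, ?_⟩
      have hv' : M v = 0 := hv
      change L v = 0
      by_contra hLv
      obtain ⟨u, -, hu⟩ := hMne
      apply hu
      have j1 := i1 v
      have j2 := i2 v
      have j3 := i3 v
      rw [hv', mul_zero, eq_comm] at j1 j2 j3
      rw [hM, (mul_eq_zero.1 j1).resolve_right hLv, (mul_eq_zero.1 j2).resolve_right hLv,
        (mul_eq_zero.1 j3).resolve_right hLv]
      ring
  rw [ea, eb, ec, ed, ee, eg, ddisc_product, ← hn1, ← hn2, ← hn3, neg_ne_zero, ← dT_comb3]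
  intro hzero
  obtain ⟨v, hv⟩ : ∃ v, v = n1 • b 0 + n2 • b 1 + n3 • (b 2 + τ • b 3) := ⟨_, rfl⟩
  rw [← hv] at hzero
  have c0 : b.coord 0 v = n1 := by simp [hv]
  have c1 : b.coord 1 v = n2 := by simp [hv]
  have c2 : b.coord 2 v = n3 := by simp [hv]
  have c3 : b.coord 3 v = τ * n3 := by simp [hv, mul_comm]
  have hv0 : v ≠ 0 := by
    rintro rfl
    apply hn
    simp only [map_zero] at c0 c1 c2
    exact ⟨c0.symm, c1.symm, c2.symm⟩
  have hvP : v ∈ plane b τ := by rw [mem_plane, c3, c2]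
  have hLv : L v = 0 := by rw [hL, c0, c1, c2, hn1, hn2, hn3]; ring
  have hMv : M v = 0 := by rw [hM, c0, c1, c2, hn1, hn2, hn3]; ring
  have hTv : T v v v = 0 := by rw [hNLM v hvP, hLv]; ring
  obtain ⟨w, hw⟩ := hT v hv0 hTv
  have hdP : ∀ w ∈ plane b τ, dT T v w = 0 := by
    intro w hw
    refine (cubic_coeffs_zero (c0 := T v v v) (c1 := dT T v w)
      (c2 := dT T w v - b.coord 2 v * L w * M w) (c3 := T w w w - b.coord 2 w * L w * M w)
        fun s => ?_).2.1
    have h2 := hNLM (v + s • w) (Submodule.add_mem _ hvP (Submodule.smul_mem _ s hw))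
    rw [T_add_smul] at h2
    rw [map_add L, map_add M, map_smul L, map_smul M, map_add, map_smul, hLv, hMv] at h2
    simp only [smul_eq_mul] at h2
    linear_combination h2
  apply hw
  have hw2 : w = (w - (b.coord 3 w - τ * b.coord 2 w) • b 3)
      + (b.coord 3 w - τ * b.coord 2 w) • b 3 := by module
  rw [hw2, dT_add_right, dT_smul_right, hzero, hdP]
  · ring
  · rw [mem_plane]
    simp

end Fiber
end Cubic27

namespace Cubic27

section Quintic
open Polynomial
variable {k : Type*} [Field k] {V : Type*} [AddCommGroup V] [Module k V]

/-- The discriminant quintic, `τ ↦ Disc T p q (r + τ s)`. -/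
noncomputable def quintic (T : V →ₗ[k] V →ₗ[k] V →ₗ[k] k) (p q r s : V) : k[X] :=
  4 * (C (dT T p s) * X + C (dT T p r)) * (C (dT T q s) * X + C (dT T q r))
      * (C (T s s s) * X ^ 3 + C (dT T s r) * X ^ 2 + C (dT T r s) * X + C (T r r r))
    + (C (pT T p q s) * X + C (pT T p q r))
      * (C (dT T s p) * X ^ 2 + C (pT T p r s) * X + C (dT T r p))
      * (C (dT T s q) * X ^ 2 + C (pT T q r s) * X + C (dT T r q))
    - (C (dT T p s) * X + C (dT T p r))
      * (C (dT T s q) * X ^ 2 + C (pT T q r s) * X + C (dT T r q)) ^ 2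
    - (C (pT T p q s) * X + C (pT T p q r)) ^ 2
      * (C (T s s s) * X ^ 3 + C (dT T s r) * X ^ 2 + C (dT T r s) * X + C (T r r r))
    - (C (dT T q s) * X + C (dT T q r))
      * (C (dT T s p) * X ^ 2 + C (pT T p r s) * X + C (dT T r p)) ^ 2

variable {T : V →ₗ[k] V →ₗ[k] V →ₗ[k] k}

lemma quintic_eval (p q r s : V) (τ : k) :
    (quintic T p q r s).eval τ = Disc T p q (r + τ • s) := by
  unfold quintic Disc disc
  have h1 : dT T p (r + τ • s) = dT T p s * τ + dT T p r := by
    rw [dT_add_right, dT_smul_right]; ring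
  have h2 : dT T q (r + τ • s) = dT T q s * τ + dT T q r := by
    rw [dT_add_right, dT_smul_right]; ring
  have h3 : pT T p q (r + τ • s) = pT T p q s * τ + pT T p q r := by
    simp only [pT, map_add, map_smul, LinearMap.add_apply, LinearMap.smul_apply, smul_eq_mul]
    ring
  have h4 : ∀ n, dT T (r + τ • s) n = dT T s n * τ ^ 2 + pT T n r s * τ + dT T r n := by
    intro n
    simp only [dT, pT, map_add, map_smul, LinearMap.add_apply, LinearMap.smul_apply, smul_eq_mul]
    ring
  rw [h1, h2, h3, h4 p, h4 q, T_add_smul]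
  simp only [eval_add, eval_sub, eval_mul, eval_pow, eval_C, eval_X, eval_ofNat]
  ring

lemma quintic_derivative_eval (p q r s : V) (τ : k) :
    (derivative (quintic T p q r s)).eval τ
      = ddisc (dT T p (r + τ • s)) (pT T p q (r + τ • s)) (dT T q (r + τ • s))
        (dT T (r + τ • s) p) (dT T (r + τ • s) q) (T (r + τ • s) (r + τ • s) (r + τ • s))
        (dT T p s) (pT T p q s) (dT T q s) (pT T p (r + τ • s) s) (pT T q (r + τ • s) s)
        (dT T (r + τ • s) s) := by
  unfold quintic ddisc
  have h1 : dT T p (r + τ • s) = dT T p s * τ + dT T p r := by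
    rw [dT_add_right, dT_smul_right]; ring
  have h2 : dT T q (r + τ • s) = dT T q s * τ + dT T q r := by
    rw [dT_add_right, dT_smul_right]; ring
  have h3 : pT T p q (r + τ • s) = pT T p q s * τ + pT T p q r := by
    simp only [pT, map_add, map_smul, LinearMap.add_apply, LinearMap.smul_apply, smul_eq_mul]
    ring
  have h4 : ∀ n, dT T (r + τ • s) n = dT T s n * τ ^ 2 + pT T n r s * τ + dT T r n := by
    intro n
    simp only [dT, pT, map_add, map_smul, LinearMap.add_apply, LinearMap.smul_apply, smul_eq_mul]
    ring
  have h5 : ∀ n, pT T n (r + τ • s) s = pT T n r s + 2 * τ * dT T s n := by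
    intro n
    simp only [dT, pT, map_add, map_smul, LinearMap.add_apply, LinearMap.smul_apply, smul_eq_mul]
    ring
  have h6 : dT T (r + τ • s) s = dT T r s + 2 * τ * dT T s r + 3 * τ ^ 2 * T s s s := by
    simp only [dT, map_add, map_smul, LinearMap.add_apply, LinearMap.smul_apply, smul_eq_mul]
    ring
  rw [h1, h2, h3, h4 p, h4 q, T_add_smul, h5, h5, h6]
  simp only [derivative_add, derivative_sub, derivative_mul, derivative_pow, derivative_C,
    derivative_X, derivative_ofNat,
    eval_add, eval_sub, eval_mul, eval_pow, eval_C, eval_X, eval_ofNat, eval_zero, eval_one,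
    eval_natCast]
  push_cast
  ring

lemma quintic_degree_aux (a1 a0 b1 b0 c1 c0 d2 d1 d0 e2 e1 e0 g3 g2 g1 g0 : k)
    (h : 4 * a1 * c1 * g3 + b1 * d2 * e2 - a1 * e2 ^ 2 - b1 ^ 2 * g3 - c1 * d2 ^ 2 ≠ 0) :
    (4 * (C a1 * X + C a0) * (C c1 * X + C c0)
      * (C g3 * X ^ 3 + C g2 * X ^ 2 + C g1 * X + C g0)
    + (C b1 * X + C b0) * (C d2 * X ^ 2 + C d1 * X + C d0) * (C e2 * X ^ 2 + C e1 * X + C e0)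
    - (C a1 * X + C a0) * (C e2 * X ^ 2 + C e1 * X + C e0) ^ 2
    - (C b1 * X + C b0) ^ 2 * (C g3 * X ^ 3 + C g2 * X ^ 2 + C g1 * X + C g0)
    - (C c1 * X + C c0) * (C d2 * X ^ 2 + C d1 * X + C d0) ^ 2 : k[X]).natDegree = 5 := by
  have hl : ∀ x1 x0 : k, (C x1 * X + C x0 : k[X]).natDegree ≤ 1 := fun _ _ => natDegree_linear_le
  have hq : ∀ x2 x1 x0 : k, (C x2 * X ^ 2 + C x1 * X + C x0 : k[X]).natDegree ≤ 2 :=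
    fun _ _ _ => natDegree_quadratic_le
  have hc : ∀ x3 x2 x1 x0 : k,
      (C x3 * X ^ 3 + C x2 * X ^ 2 + C x1 * X + C x0 : k[X]).natDegree ≤ 3 :=
    fun _ _ _ _ => natDegree_cubic_le
  have cl : ∀ x1 x0 : k, (C x1 * X + C x0 : k[X]).coeff 1 = x1 := by
    intros; simp [coeff_X, coeff_C]
  have cq : ∀ x2 x1 x0 : k, (C x2 * X ^ 2 + C x1 * X + C x0 : k[X]).coeff 2 = x2 := by
    intros; simp [coeff_X, coeff_C]
  have cc : ∀ x3 x2 x1 x0 : k,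
      (C x3 * X ^ 3 + C x2 * X ^ 2 + C x1 * X + C x0 : k[X]).coeff 3 = x3 := by
    intros; simp [coeff_X, coeff_C]
  generalize hA : (C a1 * X + C a0 : k[X]) = A
  generalize hB : (C b1 * X + C b0 : k[X]) = B
  generalize hC : (C c1 * X + C c0 : k[X]) = C'
  generalize hD : (C d2 * X ^ 2 + C d1 * X + C d0 : k[X]) = D
  generalize hE : (C e2 * X ^ 2 + C e1 * X + C e0 : k[X]) = E
  generalize hG : (C g3 * X ^ 3 + C g2 * X ^ 2 + C g1 * X + C g0 : k[X]) = G
  have tri : ∀ (P Q R : k[X]) (m n l : ℕ), P.natDegree ≤ m → Q.natDegree ≤ n → R.natDegree ≤ l →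
      (P * Q * R).natDegree ≤ m + n + l ∧
      (P * Q * R).coeff (m + n + l) = P.coeff m * Q.coeff n * R.coeff l := by
    intro P Q R m n l h1 h2 h3
    have h4 := natDegree_mul_le_of_le h1 h2
    refine ⟨natDegree_mul_le_of_le h4 h3, ?_⟩
    rw [coeff_mul_add_eq_of_natDegree_le h4 h3, coeff_mul_add_eq_of_natDegree_le h1 h2]
  obtain ⟨u1, v1⟩ := tri A C' G 1 1 3 (hA ▸ hl _ _) (hC ▸ hl _ _) (hG ▸ hc _ _ _ _)
  obtain ⟨u2, v2⟩ := tri B D E 1 2 2 (hB ▸ hl _ _) (hD ▸ hq _ _ _) (hE ▸ hq _ _ _)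
  obtain ⟨u3, v3⟩ := tri A E E 1 2 2 (hA ▸ hl _ _) (hE ▸ hq _ _ _) (hE ▸ hq _ _ _)
  obtain ⟨u4, v4⟩ := tri B B G 1 1 3 (hB ▸ hl _ _) (hB ▸ hl _ _) (hG ▸ hc _ _ _ _)
  obtain ⟨u5, v5⟩ := tri C' D D 1 2 2 (hC ▸ hl _ _) (hD ▸ hq _ _ _) (hD ▸ hq _ _ _)
  have wA : A.coeff 1 = a1 := hA ▸ cl _ _
  have wB : B.coeff 1 = b1 := hB ▸ cl _ _
  have wC : C'.coeff 1 = c1 := hC ▸ cl _ _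
  have wD : D.coeff 2 = d2 := hD ▸ cq _ _ _
  have wE : E.coeff 2 = e2 := hE ▸ cq _ _ _
  have wG : G.coeff 3 = g3 := hG ▸ cc _ _ _ _
  norm_num at u1 u2 u3 u4 u5 v1 v2 v3 v4 v5
  have e : 4 * A * C' * G + B * D * E - A * E ^ 2 - B ^ 2 * G - C' * D ^ 2
      = C 4 * (A * C' * G) + B * D * E - A * E * E - B * B * G - C' * D * D := by
    have : (C 4 : k[X]) = 4 := rfl
    rw [this]; ring
  rw [e]
  apply natDegree_eq_of_le_of_coeff_ne_zero
  · refine natDegree_sub_le_of_le (n := 5) (m := 5) (natDegree_sub_le_of_le (n := 5) (m := 5)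
      (natDegree_sub_le_of_le (n := 5) (m := 5) (natDegree_add_le_of_le (n := 5) (m := 5)
        ((natDegree_C_mul_le _ _).trans u1) u2) u3) u4) u5
  · rw [coeff_sub, coeff_sub, coeff_sub, coeff_add, coeff_C_mul, v1, v2, v3, v4, v5,
      wA, wB, wC, wD, wE, wG]
    intro h'
    apply h
    linear_combination h'

lemma quintic_natDegree (p q r s : V) (h : Disc T p q s ≠ 0) :
    (quintic T p q r s).natDegree = 5 := by
  unfold quintic
  apply quintic_degree_aux
  unfold Disc disc at h
  intro h'
  apply h
  linear_combination h'

end Quintic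

section Meeting
variable {k : Type*} [Field k] {V : Type*} [AddCommGroup V] [Module k V]
variable {T : V →ₗ[k] V →ₗ[k] V →ₗ[k] k}

/-- The lines on the surface which are different from `ℓ` and meet `ℓ`. -/
def meeting (T : V →ₗ[k] V →ₗ[k] V →ₗ[k] k) (ℓ : Submodule k V) : Set (Submodule k V) :=
  {m | IsLine T m ∧ m ≠ ℓ ∧ m ⊓ ℓ ≠ ⊥}

/-- A basis of the whole space adapted to a line. -/
lemma exists_basis [FiniteDimensional k V] (hV : Module.finrank k V = 4) {ℓ : Submodule k V}
    (hℓ : Module.finrank k ℓ = 2) :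
    ∃ b : Module.Basis (Fin 4) k V, b 0 ∈ ℓ ∧ b 1 ∈ ℓ := by
  obtain ⟨m, hm⟩ := Submodule.exists_isCompl ℓ
  have hm2 : Module.finrank k m = 2 := by
    have := Submodule.finrank_add_eq_of_isCompl hm
    omega
  let b1 : Module.Basis (Fin 2) k ℓ := Module.finBasisOfFinrankEq k ℓ hℓ
  let b2 : Module.Basis (Fin 2) k m := Module.finBasisOfFinrankEq k m hm2
  let b := ((b1.prod b2).map (Submodule.prodEquivOfIsCompl ℓ m hm)).reindex
    (finSumFinEquiv (m := 2) (n := 2))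
  refine ⟨b, ?_, ?_⟩
  · have : b 0 = b1 0 := by
      have : (finSumFinEquiv (m := 2) (n := 2)).symm 0 = Sum.inl 0 := rfl
      simp only [b, Module.Basis.reindex_apply]
      erw [this]
      simp
    rw [this]; exact (b1 0).2
  · have : b 1 = b1 1 := by
      have : (finSumFinEquiv (m := 2) (n := 2)).symm 1 = Sum.inl 1 := rfl
      simp only [b, Module.Basis.reindex_apply]
      erw [this]
      simp
    rw [this]; exact (b1 1).2

/-- A basis adapted to a line, such that the last plane contains no further lines. -/
lemma exists_good_basis [IsAlgClosed k] [FiniteDimensional k V] (hV : Module.finrank k V = 4)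
    (hT : Smooth T) {ℓ : Submodule k V} (hℓ : IsLine T ℓ) :
    ∃ b : Module.Basis (Fin 4) k V, b 0 ∈ ℓ ∧ b 1 ∈ ℓ ∧ Disc T (b 0) (b 1) (b 3) ≠ 0 := by
  have : Infinite k := IsAlgClosed.instInfinite
  obtain ⟨b, h0, h1⟩ := exists_basis hV hℓ.1
  obtain ⟨τ, hτ⟩ : ∃ τ : k, Disc T (b 0) (b 1) (b 2 + τ • b 3) ≠ 0 := by
    by_contra hcon
    push Not at hcon
    have hq : quintic T (b 0) (b 1) (b 2) (b 3) = 0 := by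
      apply Polynomial.funext
      intro τ
      rw [quintic_eval, hcon]; simp
    have h2 := (fiber_split hT hℓ b h0 h1 0 (hcon 0)).2
    rw [← quintic_derivative_eval, hq] at h2
    simp at h2
  -- new basis : b0, b1, b3, b2 + τ b3
  let f : Fin 4 → V := ![b 0, b 1, b 3, b 2 + τ • b 3]
  have hli : LinearIndependent k f := by
    rw [Fintype.linearIndependent_iff]
    intro g hg
    have e : g 0 • b 0 + g 1 • b 1 + g 3 • b 2 + (g 2 + g 3 * τ) • b 3 = 0 := by
      rw [Fin.sum_univ_four] at hg
      simp only [f, Matrix.cons_val] at hg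
      rw [← hg]; module
    have e0 : g 0 = 0 := by simpa using congrArg (b.coord 0) e
    have e1 : g 1 = 0 := by simpa using congrArg (b.coord 1) e
    have e2 : g 3 = 0 := by simpa using congrArg (b.coord 2) e
    have e3 : g 2 + g 3 * τ = 0 := by simpa using congrArg (b.coord 3) e
    have e4 : g 2 = 0 := by rw [e2] at e3; simpa using e3
    intro i; fin_cases i <;> assumption
  let b' := basisOfLinearIndependentOfCardEqFinrank hli (by simp [hV])
  have hb' : ∀ i, b' i = f i := fun i => by simp [b']
  refine ⟨b', ?_, ?_, ?_⟩
  · rw [hb']; exact h0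
  · rw [hb']; exact h1
  · rw [hb', hb', hb']; exact hτ

lemma finrank_inf_pos [FiniteDimensional k V] {A B P : Submodule k V} (hA : A ≤ P) (hB : B ≤ P)
    (h : Module.finrank k P < Module.finrank k A + Module.finrank k B) : A ⊓ B ≠ ⊥ := by
  intro hcon
  have h1 := Submodule.finrank_sup_add_finrank_inf_eq A B
  have h2 := Submodule.finrank_mono (sup_le hA hB)
  rw [hcon, finrank_bot] at h1
  omega

lemma inf_ker_coord [FiniteDimensional k V] {ℓ : Submodule k V} (hℓ : IsLine T ℓ)
    (b : Module.Basis (Fin 4) k V) (h0 : b 0 ∈ ℓ) (h1 : b 1 ∈ ℓ) (τ : k) :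
    plane b τ ⊓ LinearMap.ker (b.coord 2) = ℓ := by
  ext v
  rw [line_eq hℓ b h0 h1, Submodule.mem_inf, mem_plane, LinearMap.mem_ker]
  constructor
  · rintro ⟨h, h'⟩
    rw [h'] at h
    exact ⟨h', by simpa using h⟩
  · rintro ⟨h, h'⟩
    rw [h, h']
    simp

/-- A line on the surface meeting `ℓ` lies in one of the special planes. -/
lemma meeting_plane [IsAlgClosed k] [FiniteDimensional k V] {ℓ : Submodule k V}
    (hℓ : IsLine T ℓ) (b : Module.Basis (Fin 4) k V) (h0 : b 0 ∈ ℓ) (h1 : b 1 ∈ ℓ)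
    (h3 : Disc T (b 0) (b 1) (b 3) ≠ 0) {m : Submodule k V} (hm : m ∈ meeting T ℓ) :
    ∃ τ, Disc T (b 0) (b 1) (b 2 + τ • b 3) = 0 ∧ m ≤ plane b τ := by
  have : Infinite k := IsAlgClosed.instInfinite
  obtain ⟨hm, hne, hmeet⟩ := hm
  obtain ⟨v0, hv0, hv0ne⟩ := Submodule.exists_mem_ne_zero_of_ne_bot hmeet
  obtain ⟨v1, hv1, hv1'⟩ : ∃ v ∈ m, v ∉ ℓ := by
    by_contra hcon
    push Not at hcon
    exact hne (Submodule.eq_of_le_of_finrank_eq hcon (by rw [hm.1, hℓ.1]))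
  -- m is contained in any plane containing v0 and v1
  have key : ∀ L : V →ₗ[k] k, L v0 = 0 → L v1 = 0 → m ≤ LinearMap.ker L := by
    intro L e0 e1
    have hlt : m ⊓ ℓ < m := by
      refine lt_of_le_of_ne inf_le_left fun h => hv1' ?_
      rw [← h] at hv1
      exact hv1.2
    have hlt2 : m ⊓ ℓ ⊓ LinearMap.ker L < m ⊓ LinearMap.ker L := by
      refine lt_of_le_of_ne (inf_le_inf_right _ inf_le_left) fun h => hv1' ?_
      have : v1 ∈ m ⊓ LinearMap.ker L := ⟨hv1, e1⟩
      rw [← h] at this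
      exact this.1.2
    have hpos : 0 < Module.finrank k (m ⊓ ℓ ⊓ LinearMap.ker L : Submodule k V) := by
      rw [Nat.pos_iff_ne_zero]
      intro h
      rw [Submodule.finrank_eq_zero] at h
      have : v0 ∈ m ⊓ ℓ ⊓ LinearMap.ker L := ⟨hv0, e0⟩
      rw [h] at this
      exact hv0ne ((Submodule.mem_bot k).1 this)
    have h5 := Submodule.finrank_lt_finrank_of_lt hlt2
    have h6 : m ⊓ LinearMap.ker L = m := by
      apply Submodule.eq_of_le_of_finrank_le inf_le_left
      rw [hm.1]; omega
    rw [← h6]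
    exact inf_le_right
  obtain ⟨c2, c3⟩ := (line_eq hℓ b h0 h1).1 hv0.2
  by_cases hz : b.coord 2 v1 = 0
  · exfalso
    apply h3
    have hle := key (b.coord 2) c2 hz
    refine Disc_eq_zero hℓ hm hne h0 h1 fun v hv => ⟨b.coord 0 v, b.coord 1 v, b.coord 3 v, ?_⟩
    conv_lhs => rw [basis_expand b v]
    have : b.coord 2 v = 0 := hle hv
    rw [this, zero_smul, add_zero]
  · refine ⟨b.coord 3 v1 / b.coord 2 v1, ?_⟩
    have hle : m ≤ plane b (b.coord 3 v1 / b.coord 2 v1) := by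
      apply key
      · rw [LinearMap.sub_apply, LinearMap.smul_apply, c2, c3]; simp
      · rw [LinearMap.sub_apply, LinearMap.smul_apply, smul_eq_mul]
        field_simp
        ring
    exact ⟨Disc_eq_zero hℓ hm hne h0 h1 fun v hv => ⟨_, _, _, plane_expand b (hle hv)⟩, hle⟩

/-- Every line on the surface is met by exactly ten others. -/
theorem meeting_ncard [IsAlgClosed k] [FiniteDimensional k V] (hV : Module.finrank k V = 4)
    (hT : Smooth T) {ℓ : Submodule k V} (hℓ : IsLine T ℓ) :
    (meeting T ℓ).Finite ∧ (meeting T ℓ).ncard = 10 := by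
  classical
  have : Infinite k := IsAlgClosed.instInfinite
  obtain ⟨b, h0, h1, h3⟩ := exists_good_basis hV hT hℓ
  let δ := quintic T (b 0) (b 1) (b 2) (b 3)
  have hdeg : δ.natDegree = 5 := quintic_natDegree _ _ _ _ h3
  have hδ0 : δ ≠ 0 := by
    intro h
    rw [h] at hdeg
    simp at hdeg
  have hroot : ∀ τ, τ ∈ δ.roots.toFinset ↔ Disc T (b 0) (b 1) (b 2 + τ • b 3) = 0 := by
    intro τ
    rw [Multiset.mem_toFinset, Polynomial.mem_roots hδ0, Polynomial.IsRoot.def, quintic_eval]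
  have hnodup : δ.roots.Nodup := by
    rw [Multiset.nodup_iff_count_le_one]
    intro τ
    rw [Polynomial.count_roots]
    by_contra hcon
    push Not at hcon
    obtain ⟨hr, hd⟩ := (Polynomial.one_lt_rootMultiplicity_iff_isRoot hδ0).1 hcon
    have e1 : Disc T (b 0) (b 1) (b 2 + τ • b 3) = 0 := by
      rw [← quintic_eval]; exact hr
    have e2 := (fiber_split hT hℓ b h0 h1 τ e1).2
    rw [← quintic_derivative_eval] at e2
    exact e2 hd
  have hcard : δ.roots.toFinset.card = 5 := by
    rw [Multiset.toFinset_card_of_nodup hnodup, IsAlgClosed.card_roots_eq_natDegree, hdeg]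
  have hsplit : ∀ τ : k, ∃ m1 m2 : Submodule k V,
      Disc T (b 0) (b 1) (b 2 + τ • b 3) = 0 →
        m1 ≠ m2 ∧ ∀ m, (m = m1 ∨ m = m2) ↔ (IsLine T m ∧ m ≠ ℓ ∧ m ≤ plane b τ) := by
    intro τ
    by_cases hd : Disc T (b 0) (b 1) (b 2 + τ • b 3) = 0
    swap
    · exact ⟨⊥, ⊥, fun h => absurd h hd⟩
    obtain ⟨L, M, hLM⟩ := (fiber_split hT hℓ b h0 h1 τ hd).1
    have hP := finrank_plane b τ
    have hN := inf_ker_coord hℓ b h0 h1 τ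
    have p1 : ∀ v ∈ plane b τ, T v v v = L v * M v * b.coord 2 v :=
      fun v hv => by rw [hLM v hv]; ring
    have p2 : ∀ v ∈ plane b τ, T v v v = M v * b.coord 2 v * L v :=
      fun v hv => by rw [hLM v hv]; ring
    refine ⟨plane b τ ⊓ LinearMap.ker L, plane b τ ⊓ LinearMap.ker M, fun _ =>
      ⟨triple_distinct hV hT hP _ _ _ p1, fun m => ⟨?_, ?_⟩⟩⟩
    · rintro (rfl | rfl)
      · refine ⟨triple_isLine hV hT hP _ _ _ p1, fun h => ?_, inf_le_left⟩
        exact triple_distinct hV hT hP _ _ _ hLM (hN.trans h.symm)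
      · refine ⟨triple_isLine hV hT hP _ _ _ p2, fun h => ?_, inf_le_left⟩
        exact triple_distinct hV hT hP _ _ _ p2 (h.trans hN.symm)
    · rintro ⟨g1, g2, g3⟩
      rcases triple_lines hV hT hP _ _ _ hLM g1 g3 with h | h | h
      · exact absurd (h.trans hN) g2
      · exact Or.inl h
      · exact Or.inr h
  choose m1 m2 hm using hsplit
  have hset : meeting T ℓ = ((δ.roots.toFinset.biUnion fun τ => {m1 τ, m2 τ} :
      Finset (Submodule k V)) : Set (Submodule k V)) := by
    ext m
    simp only [Finset.coe_biUnion, Set.mem_iUnion, Finset.mem_coe, Finset.mem_insert,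
      Finset.mem_singleton, exists_prop]
    constructor
    · intro h
      obtain ⟨τ, hd, hle⟩ := meeting_plane hℓ b h0 h1 h3 h
      exact ⟨τ, (hroot τ).2 hd, ((hm τ hd).2 m).2 ⟨h.1, h.2.1, hle⟩⟩
    · rintro ⟨τ, hτ, h⟩
      obtain ⟨g1, g2, g3⟩ := ((hm τ ((hroot τ).1 hτ)).2 m).1 h
      refine ⟨g1, g2, finrank_inf_pos (P := plane b τ) g3 ?_ ?_⟩
      · rw [← inf_ker_coord hℓ b h0 h1 τ]; exact inf_le_left
      · rw [finrank_plane, g1.1, hℓ.1]; norm_num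
  have hcard2 : (δ.roots.toFinset.biUnion fun τ => {m1 τ, m2 τ} :
      Finset (Submodule k V)).card = 10 := by
    rw [Finset.card_biUnion]
    · rw [Finset.sum_congr rfl fun τ hτ => Finset.card_pair (hm τ ((hroot τ).1 hτ)).1]
      rw [Finset.sum_const, hcard]; rfl
    · intro τ hτ σ hσ hne
      change Disjoint _ _
      rw [Finset.disjoint_left]
      intro m hmτ hmσ
      rw [Finset.mem_insert, Finset.mem_singleton] at hmτ hmσ
      obtain ⟨g1, g2, g3⟩ := ((hm τ ((hroot τ).1 hτ)).2 m).1 hmτ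
      obtain ⟨-, -, g4⟩ := ((hm σ ((hroot σ).1 hσ)).2 m).1 hmσ
      apply g2
      apply Submodule.eq_of_le_of_finrank_eq
      · intro v hv
        have e1 := (mem_plane b τ v).1 (g3 hv)
        have e2 := (mem_plane b σ v).1 (g4 hv)
        have e3 : (τ - σ) * b.coord 2 v = 0 := by linear_combination e2 - e1
        have e4 := (mul_eq_zero.1 e3).resolve_left (sub_ne_zero.2 hne)
        rw [line_eq hℓ b h0 h1]
        refine ⟨e4, ?_⟩
        rw [e1, e4, mul_zero]
      · rw [g1.1, hℓ.1]
  rw [hset]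
  exact ⟨Finset.finite_toSet _, by rw [Set.ncard_coe_finset, hcard2]⟩

/-- Every line on the surface lies in a plane meeting the surface in three lines. -/
lemma exists_triangle [IsAlgClosed k] [FiniteDimensional k V] (hV : Module.finrank k V = 4)
    (hT : Smooth T) {ℓ : Submodule k V} (hℓ : IsLine T ℓ) :
    ∃ (P : Submodule k V) (N L M : V →ₗ[k] k), Module.finrank k P = 3 ∧
      ∀ v ∈ P, T v v v = N v * L v * M v := by
  obtain ⟨b, h0, h1, h3⟩ := exists_good_basis hV hT hℓ
  have hdeg : (quintic T (b 0) (b 1) (b 2) (b 3)).natDegree = 5 := quintic_natDegree _ _ _ _ h3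
  obtain ⟨τ, hτ⟩ := IsAlgClosed.exists_root (quintic T (b 0) (b 1) (b 2) (b 3)) (by
    intro h
    have := Polynomial.natDegree_eq_of_degree_eq_some (n := 0) (by simpa using h)
    rw [hdeg] at this
    norm_num at this)
  rw [Polynomial.IsRoot.def, quintic_eval] at hτ
  obtain ⟨L, M, hLM⟩ := (fiber_split hT hℓ b h0 h1 τ hτ).1
  exact ⟨plane b τ, b.coord 2, L, M, finrank_plane b τ, hLM⟩

end Meeting
end Cubic27

namespace Cubic27

section Count
variable {k : Type*} [Field k] {V : Type*} [AddCommGroup V] [Module k V]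
variable {T : V →ₗ[k] V →ₗ[k] V →ₗ[k] k}

/-- A line meeting two sides of a triangle is the third one. -/
lemma meeting_inter [IsAlgClosed k] [FiniteDimensional k V] (hV : Module.finrank k V = 4)
    (hT : Smooth T) {P : Submodule k V} (hP : Module.finrank k P = 3) (N L M : V →ₗ[k] k)
    (h : ∀ v ∈ P, T v v v = N v * L v * M v) :
    meeting T (P ⊓ LinearMap.ker N) ∩ meeting T (P ⊓ LinearMap.ker L)
      = {P ⊓ LinearMap.ker M} := by
  have : Infinite k := IsAlgClosed.instInfinite
  have hM : ∀ v ∈ P, T v v v = M v * N v * L v := fun v hv => by rw [h v hv]; ring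
  have hL : ∀ v ∈ P, T v v v = L v * M v * N v := fun v hv => by rw [h v hv]; ring
  have lN := triple_isLine hV hT hP _ _ _ h
  have lL := triple_isLine hV hT hP _ _ _ hL
  have lM := triple_isLine hV hT hP _ _ _ hM
  have dNL := triple_distinct hV hT hP _ _ _ h
  have dLM := triple_distinct hV hT hP _ _ _ hL
  have dMN := triple_distinct hV hT hP _ _ _ hM
  have meet : ∀ A B : Submodule k V, A ≤ P → B ≤ P → IsLine T A → IsLine T B → A ⊓ B ≠ ⊥ := by
    intro A B hA hB lA lB
    apply finrank_inf_pos hA hB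
    rw [hP, lA.1, lB.1]; norm_num
  ext m
  rw [Set.mem_singleton_iff]
  constructor
  · rintro ⟨⟨lm, n1, i1⟩, ⟨-, n2, i2⟩⟩
    by_cases hmP : m ≤ P
    · rcases triple_lines hV hT hP _ _ _ h lm hmP with e | e | e
      · exact absurd e n1
      · exact absurd e n2
      · exact e
    exfalso
    obtain ⟨v, hv, hv0⟩ := Submodule.exists_mem_ne_zero_of_ne_bot i1
    obtain ⟨w, hw, hw0⟩ := Submodule.exists_mem_ne_zero_of_ne_bot i2
    -- v and w lie in m ⊓ P, which is one dimensional
    have hlt : m ⊓ P < m := lt_of_le_of_ne inf_le_left fun e => hmP (by rw [← e]; exact inf_le_right)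
    have hfin : Module.finrank k (m ⊓ P : Submodule k V) < 2 := by
      have := Submodule.finrank_lt_finrank_of_lt hlt
      rwa [lm.1] at this
    have hvmP : v ∈ m ⊓ P := ⟨hv.1, hv.2.1⟩
    have hspan : k ∙ v = m ⊓ P := by
      apply Submodule.eq_of_le_of_finrank_le
      · rw [Submodule.span_singleton_le_iff_mem]; exact hvmP
      · rw [finrank_span_singleton hv0]; omega
    have hwmP : w ∈ m ⊓ P := ⟨hw.1, hw.2.1⟩
    rw [← hspan] at hwmP
    obtain ⟨c, rfl⟩ := Submodule.mem_span_singleton.1 hwmP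
    have hc : c ≠ 0 := by rintro rfl; simp at hw0
    have hvL : v ∈ P ⊓ LinearMap.ker L := by
      have := Submodule.smul_mem _ c⁻¹ hw.2
      rwa [smul_smul, inv_mul_cancel₀ hc, one_smul] at this
    have hsup : (P ⊓ LinearMap.ker N) ⊔ (P ⊓ LinearMap.ker L) = P := by
      apply Submodule.eq_of_le_of_finrank_le (sup_le inf_le_left inf_le_left)
      have hlt : P ⊓ LinearMap.ker N < (P ⊓ LinearMap.ker N) ⊔ (P ⊓ LinearMap.ker L) := by
        refine lt_of_le_of_ne le_sup_left fun e => dNL ?_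
        have : P ⊓ LinearMap.ker L ≤ P ⊓ LinearMap.ker N := by
          conv_rhs => rw [e]
          exact le_sup_right
        exact (Submodule.eq_of_le_of_finrank_eq this (by rw [lN.1, lL.1])).symm
      have := Submodule.finrank_lt_finrank_of_lt hlt
      rw [lN.1] at this
      omega
    have hsup2 : P ⊔ m = ⊤ := by
      apply Submodule.eq_top_of_finrank_eq
      have hlt : P < P ⊔ m := lt_of_le_of_ne le_sup_left fun e => hmP (by rw [e]; exact le_sup_right)
      have h1 := Submodule.finrank_lt_finrank_of_lt hlt
      have h2 := Submodule.finrank_le (P ⊔ m)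
      omega
    obtain ⟨x, hx⟩ := hT v hv0 (lm.2 v hv.1)
    apply hx
    have hx1 : x ∈ P ⊔ m := by rw [hsup2]; trivial
    rw [← hsup] at hx1
    obtain ⟨y, hy, z, hz, rfl⟩ := Submodule.mem_sup.1 hx1
    obtain ⟨y1, hy1, y2, hy2, rfl⟩ := Submodule.mem_sup.1 hy
    rw [dT_add_right, dT_add_right, (IsLine.coeffs T lm hv.1 hz).2.1, (IsLine.coeffs T lN hv.2 hy1).2.1,
      (IsLine.coeffs T lL hvL hy2).2.1]
    simp
  · rintro rfl
    exact ⟨⟨lM, dMN, meet _ _ inf_le_left inf_le_left lM lN⟩,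
      ⟨lM, dLM.symm, meet _ _ inf_le_left inf_le_left lM lL⟩⟩

theorem lines_ncard [IsAlgClosed k] [FiniteDimensional k V] (hV : Module.finrank k V = 4)
    (hT : Smooth T) {ℓ : Submodule k V} (hℓ : IsLine T ℓ) :
    {W : Submodule k V | IsLine T W}.ncard = 27 := by
  obtain ⟨P, N, L, M, hP, h⟩ := exists_triangle hV hT hℓ
  have hM : ∀ v ∈ P, T v v v = M v * N v * L v := fun v hv => by rw [h v hv]; ring
  have hL : ∀ v ∈ P, T v v v = L v * M v * N v := fun v hv => by rw [h v hv]; ring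
  have lN := triple_isLine hV hT hP _ _ _ h
  have lL := triple_isLine hV hT hP _ _ _ hL
  have lM := triple_isLine hV hT hP _ _ _ hM
  have i1 := meeting_inter hV hT hP _ _ _ h
  have i2 := meeting_inter hV hT hP _ _ _ hL
  have i3 := meeting_inter hV hT hP _ _ _ hM
  obtain ⟨fN, cN⟩ := meeting_ncard hV hT lN
  obtain ⟨fL, cL⟩ := meeting_ncard hV hT lL
  obtain ⟨fM, cM⟩ := meeting_ncard hV hT lM
  have dLM := triple_distinct hV hT hP _ _ _ hL
  generalize hn : P ⊓ LinearMap.ker N = n at *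
  generalize hl : P ⊓ LinearMap.ker L = l at *
  generalize hm : P ⊓ LinearMap.ker M = m at *
  have hset : {W : Submodule k V | IsLine T W} = meeting T n ∪ meeting T l ∪ meeting T m := by
    have eN : n ∈ meeting T l := (i2.ge rfl).1
    have eL : l ∈ meeting T m := (i3.ge rfl).1
    have eM : m ∈ meeting T n := (i1.ge rfl).1
    ext W
    constructor
    · intro hW
      change IsLine T W at hW
      have hne : W ⊓ P ≠ ⊥ := by
        apply finrank_inf_pos (P := ⊤) le_top le_top
        rw [finrank_top, hV, hW.1, hP]; norm_num
      obtain ⟨v, hv, hv0⟩ := Submodule.exists_mem_ne_zero_of_ne_bot hne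
      have key : ∀ A : Submodule k V, v ∈ A → W ⊓ A ≠ ⊥ := by
        intro A hA e
        apply hv0
        have : v ∈ W ⊓ A := ⟨hv.1, hA⟩
        rwa [e, Submodule.mem_bot] at this
      have e := hW.2 v hv.1
      rw [h v hv.2, mul_eq_zero, mul_eq_zero] at e
      rcases e with (e | e) | e
      · by_cases hWn : W = n
        · rw [hWn]; exact Or.inl (Or.inr eN)
        · exact Or.inl (Or.inl ⟨hW, hWn, key n (hn ▸ ⟨hv.2, e⟩)⟩)
      · by_cases hWn : W = l
        · rw [hWn]; exact Or.inr eL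
        · exact Or.inl (Or.inr ⟨hW, hWn, key l (hl ▸ ⟨hv.2, e⟩)⟩)
      · by_cases hWn : W = m
        · rw [hWn]; exact Or.inl (Or.inl eM)
        · exact Or.inr ⟨hW, hWn, key m (hm ▸ ⟨hv.2, e⟩)⟩
    · rintro ((hW | hW) | hW) <;> exact hW.1
  rw [hset]
  have h1 := Set.ncard_union_add_ncard_inter (meeting T n) (meeting T l) fN fL
  have h2 := Set.ncard_union_add_ncard_inter (meeting T n ∪ meeting T l) (meeting T m)
    (fN.union fL) fM
  rw [i1, Set.ncard_singleton, cN, cL] at h1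
  rw [Set.union_inter_distrib_right, i2, Set.inter_comm, i3, cM] at h2
  have h3 : ({l} ∪ {n} : Set (Submodule k V)).ncard = 2 := by
    rw [Set.singleton_union, Set.ncard_pair]
    rintro rfl
    exact (i2.ge rfl).1.2.1 rfl
  rw [h3] at h2
  omega

end Count
end Cubic27

namespace Cubic27

section Tri
variable {R S : Type*} [CommRing R] [CommRing S]

/-- The trilinear form with coefficients `c`. -/
def tri (c : Fin 4 → Fin 4 → Fin 4 → R) (a b d : Fin 4 → R) : R :=
  ∑ i, ∑ j, ∑ l, c i j l * a i * b j * d l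

/-- The coefficients of the restriction of the cubic form to the line through `p` and `q`. -/
def lineCoeff (c : Fin 4 → Fin 4 → Fin 4 → R) (p q : Fin 4 → R) : Fin 4 → R :=
  ![tri c p p p, tri c q p p + tri c p q p + tri c p p q,
    tri c p q q + tri c q p q + tri c q q p, tri c q q q]

lemma tri_map (φ : R →+* S) (c : Fin 4 → Fin 4 → Fin 4 → R) (a b d : Fin 4 → R) :
    φ (tri c a b d)
      = tri (fun i j l => φ (c i j l)) (fun i => φ (a i)) (fun i => φ (b i)) (fun i => φ (d i)) := by
  simp only [tri, map_sum, map_mul]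

lemma lineCoeff_map (φ : R →+* S) (c : Fin 4 → Fin 4 → Fin 4 → R) (p q : Fin 4 → R) (n : Fin 4) :
    φ (lineCoeff c p q n)
      = lineCoeff (fun i j l => φ (c i j l)) (fun i => φ (p i)) (fun i => φ (q i)) n := by
  fin_cases n <;> simp [lineCoeff, tri_map]

lemma tri_comb1 (c : Fin 4 → Fin 4 → Fin 4 → R) (p q b d : Fin 4 → R) (x y : R) :
    tri c (fun i => x * p i + y * q i) b d = x * tri c p b d + y * tri c q b d := by
  simp only [tri, Finset.mul_sum, ← Finset.sum_add_distrib]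
  refine Finset.sum_congr rfl fun i _ => Finset.sum_congr rfl fun j _ =>
    Finset.sum_congr rfl fun l _ => ?_
  ring

lemma tri_comb2 (c : Fin 4 → Fin 4 → Fin 4 → R) (p q a d : Fin 4 → R) (x y : R) :
    tri c a (fun i => x * p i + y * q i) d = x * tri c a p d + y * tri c a q d := by
  simp only [tri, Finset.mul_sum, ← Finset.sum_add_distrib]
  refine Finset.sum_congr rfl fun i _ => Finset.sum_congr rfl fun j _ =>
    Finset.sum_congr rfl fun l _ => ?_
  ring

lemma tri_comb3 (c : Fin 4 → Fin 4 → Fin 4 → R) (p q a b : Fin 4 → R) (x y : R) :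
    tri c a b (fun i => x * p i + y * q i) = x * tri c a b p + y * tri c a b q := by
  simp only [tri, Finset.mul_sum, ← Finset.sum_add_distrib]
  refine Finset.sum_congr rfl fun i _ => Finset.sum_congr rfl fun j _ =>
    Finset.sum_congr rfl fun l _ => ?_
  ring

lemma tri_coeff_comb (c c' : Fin 4 → Fin 4 → Fin 4 → R) (a b d : Fin 4 → R) (x y : R) :
    tri (fun i j l => x * c i j l + y * c' i j l) a b d = x * tri c a b d + y * tri c' a b d := by
  simp only [tri, Finset.mul_sum, ← Finset.sum_add_distrib]
  refine Finset.sum_congr rfl fun i _ => Finset.sum_congr rfl fun j _ =>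
    Finset.sum_congr rfl fun l _ => ?_
  ring

lemma lineCoeff_coeff_comb (c c' : Fin 4 → Fin 4 → Fin 4 → R) (p q : Fin 4 → R) (x y : R)
    (n : Fin 4) :
    lineCoeff (fun i j l => x * c i j l + y * c' i j l) p q n
      = x * lineCoeff c p q n + y * lineCoeff c' p q n := by
  fin_cases n <;> simp [lineCoeff, tri_coeff_comb] <;> ring

lemma lineCoeff_comb (c : Fin 4 → Fin 4 → Fin 4 → R) (p q : Fin 4 → R) (x y z t : R)
    (h : ∀ n, lineCoeff c p q n = 0) (n : Fin 4) :
    lineCoeff c (fun i => x * p i + y * q i) (fun i => z * p i + t * q i) n = 0 := by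
  have h0 : tri c p p p = 0 := h 0
  have h1 : tri c q p p + tri c p q p + tri c p p q = 0 := h 1
  have h2 : tri c p q q + tri c q p q + tri c q q p = 0 := h 2
  have h3 : tri c q q q = 0 := h 3
  fin_cases n <;> simp only [lineCoeff, tri_comb1, tri_comb2, tri_comb3, Fin.zero_eta, Fin.mk_one,
    Fin.reduceFinMk, Matrix.cons_val]
  · linear_combination x ^ 3 * h0 + x ^ 2 * y * h1 + x * y ^ 2 * h2 + y ^ 3 * h3
  · linear_combination 3 * x ^ 2 * z * h0 + (2 * x * z * y + x ^ 2 * t) * h1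
      + (z * y ^ 2 + 2 * x * y * t) * h2 + 3 * y ^ 2 * t * h3
  · linear_combination 3 * x * z ^ 2 * h0 + (2 * x * z * t + z ^ 2 * y) * h1
      + (x * t ^ 2 + 2 * z * y * t) * h2 + 3 * y * t ^ 2 * h3
  · linear_combination z ^ 3 * h0 + z ^ 2 * t * h1 + z * t ^ 2 * h2 + t ^ 3 * h3

/-- The coefficients of the auxiliary cubic form `x² z + y² t`. -/
def c0 : Fin 4 → Fin 4 → Fin 4 → R := fun i j l =>
  if (i = 0 ∧ j = 0 ∧ l = 2) ∨ (i = 1 ∧ j = 1 ∧ l = 3) then 1 else 0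

lemma tri_c0 (a b d : Fin 4 → R) : tri c0 a b d = a 0 * b 0 * d 2 + a 1 * b 1 * d 3 := by
  simp [tri, c0, Fin.sum_univ_four]

lemma lineCoeff_c0 (a : Fin 4 → R) :
    lineCoeff c0 ![1, 0, a 0, a 2] ![0, 1, a 1, a 3] = a := by
  ext n
  fin_cases n <;> simp [lineCoeff, tri_c0]

end Tri

section Power
open PowerSeries
variable {k : Type*} [Field k]

lemma fixed_point (G : (Fin 4 → k⟦X⟧) → (Fin 4 → k⟦X⟧))
    (hG : ∀ n a b, (∀ i, (X : k⟦X⟧) ^ n ∣ a i - b i) →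
      ∀ i, (X : k⟦X⟧) ^ (n + 1) ∣ G a i - G b i) : ∃ a, G a = a := by
  let s : ℕ → (Fin 4 → k⟦X⟧) := fun n => G^[n] 0
  have hs : ∀ n, s (n + 1) = G (s n) := fun n => Function.iterate_succ_apply' G n 0
  have h1 : ∀ n i, (X : k⟦X⟧) ^ n ∣ s (n + 1) i - s n i := by
    intro n
    induction n with
    | zero => intro i; simp
    | succ n ih =>
      intro i
      have := hG n _ _ ih i
      rwa [← hs, ← hs] at this
  have h2 : ∀ n m i, (X : k⟦X⟧) ^ n ∣ s (n + m) i - s n i := by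
    intro n m i
    induction m with
    | zero => simp
    | succ m ih =>
      have e : s (n + (m + 1)) i - s n i
          = (s (n + m + 1) i - s (n + m) i) + (s (n + m) i - s n i) := by
        rw [← add_assoc]; ring
      rw [e]
      exact dvd_add ((pow_dvd_pow _ (Nat.le_add_right n m)).trans (h1 (n + m) i)) ih
  let a : Fin 4 → k⟦X⟧ := fun i => PowerSeries.mk fun m => coeff m (s (m + 1) i)
  have h3 : ∀ n i, (X : k⟦X⟧) ^ n ∣ a i - s n i := by
    intro n i
    rw [X_pow_dvd_iff]
    intro m hm
    obtain ⟨j, rfl⟩ : ∃ j, n = m + 1 + j := ⟨n - (m + 1), by omega⟩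
    have := (X_pow_dvd_iff.1 (h2 (m + 1) j i)) m (by omega)
    rw [map_sub, sub_eq_zero] at this
    simp [a, this]
  refine ⟨a, funext fun i => ?_⟩
  rw [← sub_eq_zero]
  ext n
  have h4 : (X : k⟦X⟧) ^ (n + 1) ∣ G a i - a i := by
    have e : G a i - a i = (G a i - G (s n) i) - (a i - s (n + 1) i) := by
      rw [hs]; ring
    rw [e]
    exact dvd_sub (hG n _ _ (h3 n) i) (h3 (n + 1) i)
  rw [X_pow_dvd_iff.1 h4 n (by omega)]
  simp

/-- The deformation of the auxiliary cubic in the direction of `c` contains a line. -/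
lemma exists_power_line (c : Fin 4 → Fin 4 → Fin 4 → k⟦X⟧) :
    ∃ a : Fin 4 → k⟦X⟧, ∀ n, lineCoeff (fun i j l => 1 * c0 i j l + X * c i j l)
      ![1, 0, a 0, a 2] ![0, 1, a 1, a 3] n = 0 := by
  obtain ⟨a, ha⟩ := fixed_point
    (fun a n => - (X * lineCoeff c ![1, 0, a 0, a 2] ![0, 1, a 1, a 3] n)) (by
      intro n a b hab i
      have e : (- (X * lineCoeff c ![1, 0, a 0, a 2] ![0, 1, a 1, a 3] i))
          - (- (X * lineCoeff c ![1, 0, b 0, b 2] ![0, 1, b 1, b 3] i))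
          = X * (lineCoeff c ![1, 0, b 0, b 2] ![0, 1, b 1, b 3] i
            - lineCoeff c ![1, 0, a 0, a 2] ![0, 1, a 1, a 3] i) := by ring
      rw [e, pow_succ']
      apply mul_dvd_mul_left
      rw [← Ideal.mem_span_singleton, ← Ideal.Quotient.eq, lineCoeff_map, lineCoeff_map]
      have hq : ∀ i, Ideal.Quotient.mk (Ideal.span {(X : k⟦X⟧) ^ n}) (b i)
          = Ideal.Quotient.mk (Ideal.span {(X : k⟦X⟧) ^ n}) (a i) := by
        intro i
        rw [eq_comm, Ideal.Quotient.eq, Ideal.mem_span_singleton]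
        exact hab i
      congr 1
      · funext i; fin_cases i <;> simp [hq]
      · funext i; fin_cases i <;> simp [hq])
  refine ⟨a, fun n => ?_⟩
  rw [lineCoeff_coeff_comb, lineCoeff_c0]
  have := congrFun ha n
  linear_combination -this

end Power
end Cubic27

namespace Cubic27

section Specialize
variable {k : Type*} [Field k]

/-- Descending a solution to an algebraically closed field. -/
lemma descend [IsAlgClosed k] {K : Type*} [Field K] [Algebra k K]
    (c : Fin 4 → Fin 4 → Fin 4 → k) (p q : Fin 4 → K) (i j : Fin 4)
    (h : ∀ n, lineCoeff (fun i j l => algebraMap k K (c i j l)) p q n = 0)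
    (hpi : p i = 1) (hpj : p j = 0) (hqi : q i = 0) (hqj : q j = 1) :
    ∃ p q : Fin 4 → k, (∀ n, lineCoeff c p q n = 0) ∧ p i = 1 ∧ p j = 0 ∧ q i = 0 ∧ q j = 1 := by
  let s : Set K := Set.range p ∪ Set.range q
  have hs : s.Finite := (Set.finite_range p).union (Set.finite_range q)
  let S := Algebra.adjoin k s
  have hft : Algebra.FiniteType k S := by
    rw [← Subalgebra.fg_iff_finiteType]
    exact Subalgebra.fg_def.2 ⟨s, hs, rfl⟩
  obtain ⟨m, hm⟩ := Ideal.exists_maximal S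
  let := Ideal.Quotient.field m
  have := finite_of_finite_type_of_isJacobsonRing k (S ⧸ m)
  have hbij := IsAlgClosed.algebraMap_bijective_of_isIntegral (k := k) (K := S ⧸ m)
  let e : k ≃ₐ[k] (S ⧸ m) := AlgEquiv.ofBijective (Algebra.ofId k (S ⧸ m)) hbij
  let f : S →ₐ[k] k := e.symm.toAlgHom.comp (Ideal.Quotient.mkₐ k m)
  let p' : Fin 4 → S := fun i => ⟨p i, Algebra.subset_adjoin (Or.inl ⟨i, rfl⟩)⟩
  let q' : Fin 4 → S := fun i => ⟨q i, Algebra.subset_adjoin (Or.inr ⟨i, rfl⟩)⟩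
  have h' : ∀ n, lineCoeff (fun i j l => algebraMap k S (c i j l)) p' q' n = 0 := by
    intro n
    apply Subtype.val_injective
    have := lineCoeff_map (S.val : S →+* K) (fun i j l => algebraMap k S (c i j l)) p' q' n
    exact this.trans (h n)
  have e1 : p' i = 1 := Subtype.ext hpi
  have e2 : p' j = 0 := Subtype.ext hpj
  have e3 : q' i = 0 := Subtype.ext hqi
  have e4 : q' j = 1 := Subtype.ext hqj
  refine ⟨fun i => f (p' i), fun i => f (q' i), fun n => ?_, ?_, ?_, ?_, ?_⟩
  · have := lineCoeff_map (f : S →+* k) (fun i j l => algebraMap k S (c i j l)) p' q' n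
    rw [h', map_zero] at this
    simpa using this.symm
  · simp [e1]
  · simp [e2]
  · simp [e3]
  · simp [e4]

lemma exists_valuation {L : Type*} [Field L] (φ : k →+* L) (s : L)
    (hs : ∀ g : Polynomial k, g.eval₂ φ s = 0 → g = 0) :
    ∃ B : ValuationSubring L, (∀ a, φ a ∈ B) ∧ s ∈ B.nonunits := by
  let A : Subring L := (Polynomial.eval₂RingHom φ s).range
  let s' : A := ⟨s, Polynomial.X, by simp⟩
  obtain ⟨B, hAB, hB⟩ := Ideal.image_subset_nonunits_valuationSubring (Ideal.span {s'}) (by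
    rw [Ne, Ideal.span_singleton_eq_top]
    intro hu
    obtain ⟨⟨-, f, rfl⟩, ht⟩ := isUnit_iff_exists_inv.1 hu
    have ht' : s * f.eval₂ φ s = 1 := congrArg Subtype.val ht
    have := hs (Polynomial.X * f - 1) (by
      rw [Polynomial.eval₂_sub, Polynomial.eval₂_mul, Polynomial.eval₂_X, ht']; simp)
    have := congrArg (Polynomial.eval 0) this
    simp at this)
  refine ⟨B, fun a => hAB ⟨Polynomial.C a, by simp⟩, hB ⟨s', ?_, rfl⟩⟩
  exact Ideal.mem_span_singleton_self s'

/-- Specialising a line along a valuation. -/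
lemma specialize_line [IsAlgClosed k] {L : Type*} [Field L] (φ : k →+* L) (s : L)
    (B : ValuationSubring L) (hφ : ∀ a, φ a ∈ B) (hs : s ∈ B.nonunits)
    (c : Fin 4 → Fin 4 → Fin 4 → k) (p q : Fin 4 → L)
    (h : ∀ n, lineCoeff (fun i j l => s * c0 i j l + 1 * φ (c i j l)) p q n = 0)
    (h01 : p 0 * q 1 - p 1 * q 0 ≠ 0) :
    ∃ (p q : Fin 4 → k) (i j : Fin 4),
      (∀ n, lineCoeff c p q n = 0) ∧ p i = 1 ∧ p j = 0 ∧ q i = 0 ∧ q j = 1 := by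
  obtain ⟨⟨i, j⟩, hij⟩ := Finite.exists_max
    (fun x : Fin 4 × Fin 4 => B.valuation (p x.1 * q x.2 - p x.2 * q x.1))
  simp only [Prod.forall] at hij
  have hne : p i * q j - p j * q i ≠ 0 := by
    intro h0
    have := hij 0 1
    rw [h0, map_zero, le_zero_iff, map_eq_zero] at this
    exact h01 this
  set D := p i * q j - p j * q i with hD
  have hmem : ∀ a b, (p a * q b - p b * q a) / D ∈ B := by
    intro a b
    rw [← B.valuation_le_one_iff, map_div₀]
    exact div_le_one_of_le₀ (hij a b) zero_le
  have hsB : s ∈ B := B.nonunits_subset hs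
  have hmax : (⟨s, hsB⟩ : B) ∈ IsLocalRing.maximalIdeal B := B.coe_mem_nonunits_iff.1 hs
  let p1 : Fin 4 → L := fun l => q j / D * p l + (- p j / D) * q l
  let q1 : Fin 4 → L := fun l => (- q i / D) * p l + p i / D * q l
  have hp1 : ∀ l, p1 l = (p l * q j - p j * q l) / D := fun l => by simp only [p1]; ring
  have hq1 : ∀ l, q1 l = (p i * q l - p l * q i) / D := fun l => by simp only [q1]; ring
  have h1 := lineCoeff_comb _ p q (q j / D) (- p j / D) (- q i / D) (p i / D) h
  let p2 : Fin 4 → B := fun l => ⟨p1 l, by rw [hp1]; exact hmem _ _⟩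
  let q2 : Fin 4 → B := fun l => ⟨q1 l, by rw [hq1]; exact hmem _ _⟩
  let ψ : k →+* B := φ.codRestrict B.toSubring hφ
  have h2 : ∀ n, lineCoeff (fun i j l => (⟨s, hsB⟩ : B) * c0 i j l + 1 * ψ (c i j l)) p2 q2 n
      = 0 := by
    intro n
    apply Subtype.val_injective
    have := lineCoeff_map B.subtype
      (fun i j l => (⟨s, hsB⟩ : B) * c0 i j l + 1 * ψ (c i j l)) p2 q2 n
    refine this.trans ((Eq.trans ?_ (h1 n)))
    congr 1
    funext i j l
    rw [map_add, map_mul, map_mul, map_one]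
    congr 2
    simp only [c0]
    split_ifs <;> simp
  let π := IsLocalRing.residue B
  algebraize [π.comp ψ]
  have h3 : ∀ n, lineCoeff (fun i j l => algebraMap k (IsLocalRing.ResidueField B) (c i j l))
      (fun l => π (p2 l)) (fun l => π (q2 l)) n = 0 := by
    intro n
    have := lineCoeff_map π
      (fun i j l => (⟨s, hsB⟩ : B) * c0 i j l + 1 * ψ (c i j l)) p2 q2 n
    rw [h2, map_zero] at this
    rw [this]
    congr 1
    funext i j l
    have hz : π ⟨s, hsB⟩ = 0 := (IsLocalRing.residue_eq_zero_iff _).2 hmax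
    rw [map_add, map_mul, map_mul, map_one, hz, zero_mul, zero_add, one_mul]
    rfl
  have e1 : p2 i = 1 := Subtype.ext (by
    change p1 i = 1
    rw [hp1, ← hD, div_self hne])
  have e2 : p2 j = 0 := Subtype.ext (by
    change p1 j = 0
    rw [hp1, sub_self, zero_div])
  have e3 : q2 i = 0 := Subtype.ext (by
    change q1 i = 0
    rw [hq1, sub_self, zero_div])
  have e4 : q2 j = 1 := Subtype.ext (by
    change q1 j = 1
    rw [hq1, ← hD, div_self hne])
  obtain ⟨p3, q3, r⟩ := descend c _ _ i j h3 (by rw [e1, map_one]) (by rw [e2, map_zero])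
    (by rw [e3, map_zero]) (by rw [e4, map_one])
  exact ⟨p3, q3, i, j, r⟩

open PowerSeries in
/-- Every cubic surface contains a line. -/
theorem exists_line [IsAlgClosed k] (c : Fin 4 → Fin 4 → Fin 4 → k) :
    ∃ (p q : Fin 4 → k) (i j : Fin 4),
      (∀ n, lineCoeff c p q n = 0) ∧ p i = 1 ∧ p j = 0 ∧ q i = 0 ∧ q j = 1 := by
  obtain ⟨a, ha⟩ := exists_power_line (fun i j l => C (c i j l))
  let L := FractionRing k⟦X⟧
  let ι : k⟦X⟧ →+* L := algebraMap k⟦X⟧ L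
  have hι : Function.Injective ι := IsFractionRing.injective k⟦X⟧ L
  let φ : k →+* L := ι.comp C
  let x : L := ι X
  have hx : x ≠ 0 := by
    intro h
    exact X_ne_zero (hι (h.trans (map_zero ι).symm))
  obtain ⟨B, hB1, hB2⟩ := exists_valuation φ x⁻¹ (by
    intro g hg
    let : Invertible x⁻¹ := invertibleOfNonzero (inv_ne_zero hx)
    have h1 := (Polynomial.eval₂_reverse_eq_zero_iff φ x⁻¹ g).2 hg
    rw [invOf_eq_inv, inv_inv, ← Polynomial.hom_eval₂, Polynomial.eval₂_C_X_eq_coe] at h1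
    have h2 := hι (h1.trans (map_zero ι).symm)
    rwa [Polynomial.coe_eq_zero_iff, Polynomial.reverse_eq_zero] at h2)
  refine specialize_line φ x⁻¹ B hB1 hB2 c (fun l => ι (![1, 0, a 0, a 2] l))
    (fun l => ι (![0, 1, a 1, a 3] l)) (fun n => ?_) (by simp)
  have h1 := lineCoeff_map ι (fun i j l => 1 * c0 i j l + X * C (c i j l))
    ![1, 0, a 0, a 2] ![0, 1, a 1, a 3] n
  rw [ha, map_zero] at h1
  have e : (fun i j l => ι (1 * c0 i j l + X * C (c i j l)))
      = fun i j l => 1 * c0 i j l + x * φ (c i j l) := by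
    funext i j l
    rw [map_add, map_mul, map_mul, map_one]
    congr 2
    simp only [c0]
    split_ifs <;> simp
  rw [e, lineCoeff_coeff_comb] at h1
  rw [lineCoeff_coeff_comb]
  generalize lineCoeff (fun i j l => φ (c i j l)) _ _ n = b at h1 ⊢
  linear_combination (-x⁻¹) * h1 - b * mul_inv_cancel₀ hx

end Specialize
end Cubic27

namespace Cubic27

section Convert
variable {k : Type*} [Field k]

/-- The trilinear form with coefficients `c`, as a linear map. -/
noncomputable def form (c : Fin 4 → Fin 4 → Fin 4 → k) :
    (Fin 4 → k) →ₗ[k] (Fin 4 → k) →ₗ[k] (Fin 4 → k) →ₗ[k] k :=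
  ∑ i, ∑ j, ∑ l, c i j l • (LinearMap.proj i : (Fin 4 → k) →ₗ[k] k).smulRight
    ((LinearMap.proj j : (Fin 4 → k) →ₗ[k] k).smulRight (LinearMap.proj l : (Fin 4 → k) →ₗ[k] k))

lemma form_apply (c : Fin 4 → Fin 4 → Fin 4 → k) (a b d : Fin 4 → k) :
    form c a b d = tri c a b d := by
  simp only [form, tri, LinearMap.sum_apply, LinearMap.smul_apply, LinearMap.smulRight_apply,
    LinearMap.proj_apply, smul_eq_mul]
  refine Finset.sum_congr rfl fun i _ => Finset.sum_congr rfl fun j _ =>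
    Finset.sum_congr rfl fun l _ => ?_
  ring

open MvPolynomial in
/-- The cubic form with coefficients `c`. -/
noncomputable def poly (c : Fin 4 → Fin 4 → Fin 4 → k) : MvPolynomial (Fin 4) k :=
  ∑ i, ∑ j, ∑ l, C (c i j l) * X i * X j * X l

open MvPolynomial in
lemma poly_add (c c' : Fin 4 → Fin 4 → Fin 4 → k) :
    poly (fun i j l => c i j l + c' i j l) = poly c + poly c' := by
  simp only [poly, ← Finset.sum_add_distrib, map_add, add_mul]

open MvPolynomial in
lemma eval_poly (c : Fin 4 → Fin 4 → Fin 4 → k) (v : Fin 4 → k) :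
    eval v (poly c) = form c v v v := by
  simp only [form_apply, poly, tri, map_sum, map_mul, eval_C, eval_X]

open MvPolynomial in
lemma eval_pderiv_poly (c : Fin 4 → Fin 4 → Fin 4 → k) (v : Fin 4 → k) (n : Fin 4) :
    eval v (pderiv n (poly c)) = dT (form c) v (Pi.single n 1) := by
  simp only [dT, form_apply, poly, tri, map_sum, ← Finset.sum_add_distrib]
  refine Finset.sum_congr rfl fun i _ => Finset.sum_congr rfl fun j _ =>
    Finset.sum_congr rfl fun l _ => ?_
  simp only [Derivation.leibniz, pderiv_C, pderiv_X, smul_eq_mul, map_add, map_mul, eval_C, eval_X,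
    Pi.single_apply, map_zero, smul_zero]
  simp only [apply_ite (eval v), map_one, map_zero, eq_comm (a := n)]
  ring

lemma exists_triple (d : Fin 4 →₀ ℕ) (hd : d.degree = 3) :
    ∃ i j l, d = Finsupp.single i 1 + Finsupp.single j 1 + Finsupp.single l 1 := by
  have key : ∀ (m : ℕ) (d : Fin 4 →₀ ℕ), d.degree = m + 1 →
      ∃ i d', d'.degree = m ∧ d = d' + Finsupp.single i 1 := by
    intro m d hd
    have hne : d ≠ 0 := by rintro rfl; simp at hd
    obtain ⟨i, hi⟩ := Finsupp.ne_iff.1 hne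
    have hle : Finsupp.single i 1 ≤ d := by
      rw [Finsupp.single_le_iff]
      exact Nat.one_le_iff_ne_zero.2 hi
    have e : d - Finsupp.single i 1 + Finsupp.single i 1 = d := tsub_add_cancel_of_le hle
    refine ⟨i, d - Finsupp.single i 1, ?_, e.symm⟩
    have := congrArg Finsupp.degree e
    rw [map_add, Finsupp.degree_single, hd] at this
    omega
  obtain ⟨l, d1, h1, e1⟩ := key 2 d hd
  obtain ⟨j, d2, h2, e2⟩ := key 1 d1 h1
  obtain ⟨i, d3, h3, e3⟩ := key 0 d2 h2
  rw [Finsupp.degree_eq_zero_iff] at h3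
  exact ⟨i, j, l, by rw [e1, e2, e3, h3, zero_add]⟩

open MvPolynomial in
lemma exists_poly (F : MvPolynomial (Fin 4) k) (hF : F.IsHomogeneous 3) :
    ∃ c, F = poly c := by
  classical
  have key : ∀ s : Finset (Fin 4 →₀ ℕ), (∀ d ∈ s, d.degree = 3) →
      ∃ c, ∑ d ∈ s, monomial d (coeff d F) = poly c := by
    intro s
    induction s using Finset.induction_on with
    | empty => intro _; exact ⟨fun _ _ _ => 0, by simp [poly]⟩
    | insert d s hds ih =>
      intro hs
      obtain ⟨c, hc⟩ := ih fun d hd => hs d (Finset.mem_insert_of_mem hd)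
      obtain ⟨i, j, l, hd⟩ := exists_triple d (hs d (Finset.mem_insert_self _ _))
      refine ⟨fun i' j' l' => (if i' = i ∧ j' = j ∧ l' = l then coeff d F else 0) + c i' j' l', ?_⟩
      rw [poly_add, Finset.sum_insert hds, hc]
      congr 1
      have e : (monomial d) (coeff d F) = C (coeff d F) * X i * X j * X l := by
        generalize coeff d F = a
        rw [hd, X, X, X, C_mul_monomial, monomial_mul, monomial_mul, mul_one, mul_one, mul_one]
      rw [e, poly, Finset.sum_eq_single i, Finset.sum_eq_single j, Finset.sum_eq_single l]
      · simp
      · intro l' _ h; simp [h]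
      · simp
      · intro l' _ h; simp [h]
      · simp
      · intro l' _ h; simp [h]
      · simp
  obtain ⟨c, hc⟩ := key F.support (fun d hd => by
    have := hF (mem_support_iff.1 hd)
    rw [Finsupp.degree_eq_weight_one]
    exact this)
  exact ⟨c, by rw [← hc]; exact F.as_sum⟩

/-- Every cubic form vanishes on some line. -/
lemma exists_isLine [IsAlgClosed k] (c : Fin 4 → Fin 4 → Fin 4 → k) :
    ∃ W, IsLine (form c) W := by
  obtain ⟨p, q, i, j, h, hpi, hpj, hqi, hqj⟩ := exists_line c
  refine ⟨Submodule.span k {p, q}, ?_, ?_⟩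
  · have hli : LinearIndependent k ![p, q] := by
      rw [LinearIndependent.pair_iff]
      intro s t hst
      have h1 := congrFun hst i
      have h2 := congrFun hst j
      simp [hpi, hqi, hpj, hqj] at h1 h2
      exact ⟨h1, h2⟩
    have := finrank_span_eq_card hli
    rw [Matrix.range_cons, Matrix.range_cons, Matrix.range_empty, Set.union_empty,
      Set.singleton_union] at this
    simpa using this
  · intro v hv
    obtain ⟨x, y, rfl⟩ := Submodule.mem_span_pair.1 hv
    rw [form_apply]
    exact lineCoeff_comb c p q x y 0 0 h 0

end Convert
end Cubic27


open MvPolynomial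

/-- A smooth cubic surface in `ℙ³` over an algebraically closed field
contains exactly 27 lines. Lines in `ℙ³` are 2-dimensional linear subspaces of `k⁴`. -/
theorem smooth_cubic_surface_has_27_lines
    (k : Type) [Field k] [IsAlgClosed k]
    (F : MvPolynomial (Fin 4) k) (hdeg : F.IsHomogeneous 3)
    -- smoothness: the partial derivatives have no common zero besides the origin
    (hsmooth : ∀ v : Fin 4 → k, v ≠ 0 → eval v F = 0 → ∃ i, eval v (pderiv i F) ≠ 0) :
    {W : Submodule k (Fin 4 → k) |
      Module.finrank k W = 2 ∧ ∀ v ∈ W, eval v F = 0}.ncard = 27 := by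
  obtain ⟨c, rfl⟩ := Cubic27.exists_poly F hdeg
  simp only [Cubic27.eval_poly, Cubic27.eval_pderiv_poly] at hsmooth ⊢
  have hT : Cubic27.Smooth (Cubic27.form c) := by
    intro v hv h
    obtain ⟨i, hi⟩ := hsmooth v hv h
    exact ⟨_, hi⟩
  obtain ⟨W, hW⟩ := Cubic27.exists_isLine c
  exact Cubic27.lines_ncard (by simp) hT hW
end
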